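/- arXiv:1503.06290 — 3 statements merged into one kernel-verified Lean document; each statement's English description precedes it below -/
import Mathlib

section
/- Let ν, μ, z ∈ ℂ with Re ν > 0, 0 < Re μ < 2 and Re μ < Re ν + 1. Then (e^(−z²/2)/(Γ(ν)·Γ(ν+1−μ))) · [ (∫₀^∞ e^(−z·t − t²/2) t^(ν−1) dt)·(∫₀^∞ e^(z·s − s²/2) s^(ν−μ) ds) − (∫₀^∞ e^(z·t − t²/2) t^(ν−1) dt)·(∫₀^∞ e^(−z·s − s²/2) s^(ν−μ) ds) ] = (4/√(2π)) · cos(πμ/2) · ∫₀^∞ sin(z·x) · x^(μ−1) · e^(−x²/2) · ((1/Γ(ν)) ∫₀^∞ e^(−x²·u) u^(ν−1)(1+u)^(μ−ν−1) du) dx. (This is the Fourier-sine identity (27): D₋ν(z)·D_(μ−1−ν)(−z) − D₋ν(−z)·D_(μ−1−ν)(z) = (4/√(2π)) cos(πμ/2) ∫₀^∞ sin(zx) x^(μ−1) e^(−x²/2) Ψ(ν,μ;x²) dx with a = 1.) -/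
open MeasureTheory Complex Set

noncomputable def covD (p : ℝ × ℝ) : ℝ × ℝ →L[ℝ] ℝ × ℝ :=
  (Matrix.toLin (.finTwoProd ℝ) (.finTwoProd ℝ)
    !![Real.exp (-p.2), -(p.1 * Real.exp (-p.2)); Real.exp p.2, p.1 * Real.exp p.2]).toContinuousLinearMap

noncomputable def covM (p : ℝ × ℝ) : ℝ × ℝ := (p.1 * Real.exp (-p.2), p.1 * Real.exp p.2)

theorem covM_hasFDerivAt (p : ℝ × ℝ) : HasFDerivAt covM (covD p) p := by
  unfold covD
  rw [Matrix.toLin_finTwoProd_toContinuousLinearMap]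
  have h1 : HasFDerivAt (fun p : ℝ × ℝ => Real.exp (-p.2))
     ((-Real.exp (-p.2)) • ContinuousLinearMap.snd ℝ ℝ ℝ) p := by
    have h0 : HasDerivAt (fun y : ℝ => Real.exp (-y)) (-Real.exp (-p.2)) p.2 := by
      simpa using (hasDerivAt_neg p.2).exp
    exact h0.comp_hasFDerivAt p hasFDerivAt_snd
  have h2 : HasFDerivAt (fun p : ℝ × ℝ => Real.exp (p.2))
     ((Real.exp (p.2)) • ContinuousLinearMap.snd ℝ ℝ ℝ) p := by
    exact (((Real.hasDerivAt_exp p.2)).comp_hasFDerivAt p hasFDerivAt_snd)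
  have := HasFDerivAt.prodMk (𝕜 := ℝ) (hasFDerivAt_fst.mul h1) (hasFDerivAt_fst.mul h2)
  refine this.congr_fderiv ?_
  ext <;> simp

theorem covD_det (p : ℝ × ℝ) : (covD p).det = 2 * p.1 := by
  unfold covD
  simp only [LinearMap.det_toContinuousLinearMap, LinearMap.det_toLin,
    Matrix.det_fin_two_of]
  have : Real.exp (-p.2) * Real.exp p.2 = 1 := by rw [← Real.exp_add]; simp
  linear_combination (2 * p.1) * this

theorem covM_inj : InjOn covM (Ioi 0 ×ˢ univ) := by
  rintro ⟨a, b⟩ ⟨ha, -⟩ ⟨c, d⟩ ⟨hc, -⟩ h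
  simp only [covM, Prod.mk.injEq, mem_Ioi] at *
  obtain ⟨h1, h2⟩ := h
  have l1 := congrArg Real.log h1
  have l2 := congrArg Real.log h2
  rw [Real.log_mul ha.ne' (Real.exp_pos _).ne', Real.log_mul hc.ne' (Real.exp_pos _).ne', Real.log_exp, Real.log_exp] at l1 l2
  have : b = d := by linarith
  subst this
  refine ⟨Real.log_injOn_pos ha hc (by linarith), rfl⟩

theorem covM_image : covM '' (Ioi 0 ×ˢ univ) = Ioi 0 ×ˢ Ioi 0 := by
  ext ⟨t, s⟩
  simp only [mem_image, mem_prod, mem_Ioi, mem_univ, and_true, Prod.exists, covM, Prod.mk.injEq]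
  constructor
  · rintro ⟨a, b, ha, rfl, rfl⟩
    constructor <;> positivity
  · rintro ⟨ht, hs⟩
    refine ⟨Real.exp ((Real.log t + Real.log s)/2), (Real.log s - Real.log t)/2, by positivity, ?_, ?_⟩
    · rw [← Real.exp_add]; ring_nf; exact Real.exp_log ht
    · rw [← Real.exp_add]; ring_nf; exact Real.exp_log hs

theorem cov_integral (f : ℝ × ℝ → ℂ) :
    ∫ p in Ioi (0:ℝ) ×ˢ Ioi (0:ℝ), f p = ∫ p in Ioi (0:ℝ) ×ˢ (univ : Set ℝ), (2 * p.1 : ℂ) * f (covM p) := by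
  rw [← covM_image, integral_image_eq_integral_abs_det_fderiv_smul volume
    (measurableSet_Ioi.prod MeasurableSet.univ) (fun x _ => (covM_hasFDerivAt x).hasFDerivWithinAt) covM_inj]
  refine setIntegral_congr_fun (measurableSet_Ioi.prod MeasurableSet.univ) ?_
  rintro ⟨a, b⟩ ⟨ha, -⟩
  simp only [mem_Ioi] at ha
  simp [covD_det, abs_of_pos ha]

theorem cov_integrable (f : ℝ × ℝ → ℂ) (hf : IntegrableOn f (Ioi (0:ℝ) ×ˢ Ioi (0:ℝ))) :
    IntegrableOn (fun p : ℝ × ℝ => (2 * p.1 : ℂ) * f (covM p)) (Ioi (0:ℝ) ×ˢ (univ : Set ℝ)) := by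
  rw [← covM_image, integrableOn_image_iff_integrableOn_abs_det_fderiv_smul volume
    (measurableSet_Ioi.prod MeasurableSet.univ) (fun x _ => (covM_hasFDerivAt x).hasFDerivWithinAt) covM_inj] at hf
  refine hf.congr_fun ?_ (measurableSet_Ioi.prod MeasurableSet.univ)
  rintro ⟨a, b⟩ ⟨ha, -⟩
  simp only [mem_Ioi] at ha
  simp [covD_det, abs_of_pos ha]

theorem exp_abs_integrable {ε : ℝ} (hε : 0 < ε) : Integrable (fun x : ℝ => Real.exp (-ε * |x|)) := by
  rw [← integrableOn_univ, ← Iic_union_Ioi (a := (0:ℝ))]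
  refine IntegrableOn.union ?_ ?_
  · refine (integrableOn_exp_mul_Iic hε 0).congr_fun ?_ measurableSet_Iic
    intro x hx
    simp only [mem_Iic] at hx
    simp [abs_of_nonpos hx]
  · refine (integrableOn_exp_mul_Ioi (neg_lt_zero.mpr hε) 0).congr_fun ?_ measurableSet_Ioi
    intro x hx
    simp only [mem_Ioi] at hx
    simp [abs_of_pos hx]

theorem gauss_int {κ : ℝ} (hκ : -1 < κ) (c : ℝ) :
    IntegrableOn (fun x : ℝ => x ^ κ * Real.exp (c * x - x^2/2)) (Ioi 0) := by
  refine Integrable.mono' (((integrableOn_rpow_mul_exp_neg_mul_sq (b := 1/4) (by norm_num) hκ)).const_mul (Real.exp (c^2))) ?_ ?_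
  · refine ContinuousOn.aestronglyMeasurable ?_ measurableSet_Ioi
    refine ContinuousOn.mul ?_ (by fun_prop)
    exact ContinuousOn.rpow_const continuousOn_id (fun x hx => Or.inl (ne_of_gt hx))
  · refine (ae_restrict_iff' measurableSet_Ioi).2 (Filter.Eventually.of_forall fun x hx => ?_)
    simp only [mem_Ioi] at hx
    rw [Real.norm_of_nonneg (by positivity)]
    have : Real.exp (c * x - x^2/2) ≤ Real.exp (c^2) * Real.exp (-(1/4) * x^2) := by
      rw [← Real.exp_add]
      apply Real.exp_le_exp.2
      nlinarith [sq_nonneg (c - x/2)]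
    calc _ ≤ x^κ * (Real.exp (c^2) * Real.exp (-(1/4) * x^2)) := by gcongr
      _ = _ := by ring

theorem strip_shift (g : ℂ → ℂ) (hg : Differentiable ℂ g) (c C ε : ℝ) (hε : 0 < ε)
    (hb : ∀ x y : ℝ, |y| ≤ |c| → ‖g (x + y * I)‖ ≤ C * Real.exp (-ε * |x|)) :
    ∫ x : ℝ, g x = ∫ x : ℝ, g (x + c * I) := by
  have hint : ∀ y : ℝ, |y| ≤ |c| → Integrable (fun x : ℝ => g (x + y * I)) := by
    intro y hy
    refine Integrable.mono' ((exp_abs_integrable hε).const_mul C) ?_ (Filter.Eventually.of_forall fun x => hb x y hy)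
    have := hg.continuous
    exact Continuous.aestronglyMeasurable (by fun_prop)
  have h0 : Integrable (fun x : ℝ => g x) := by simpa using hint 0 (by simp)
  have hc := hint c le_rfl
  have t0 := intervalIntegral_tendsto_integral h0 Filter.tendsto_neg_atTop_atBot Filter.tendsto_id
  have tc := intervalIntegral_tendsto_integral hc Filter.tendsto_neg_atTop_atBot Filter.tendsto_id
  have key : ∀ T : ℝ, ‖(∫ x in (-T)..(id T), g x) - ∫ x in (-T)..(id T), g (x + c * I)‖
      ≤ (2 * C * |c|) * Real.exp (-ε * |T|) := by
    intro T
    have R := integral_boundary_rect_eq_zero_of_differentiableOn g (-T) (T + c * I) hg.differentiableOn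
    simp at R
    have e : (∫ x in (-T)..(id T), g x) - ∫ x in (-T)..(id T), g (x + c * I) =
      I * (∫ y in (0:ℝ)..c, g (-T + y * I)) - I * ∫ y in (0:ℝ)..c, g (T + y * I) := by
      simp only [id]
      linear_combination R
    rw [e]
    have hy : ∀ y ∈ uIoc 0 c, |y| ≤ |c| := by
      intro y hy
      rcases le_total 0 c with h | h
      · rw [uIoc_of_le h] at hy; rw [abs_of_pos hy.1, abs_of_nonneg h]; exact hy.2
      · rw [uIoc_of_ge h] at hy; rw [abs_of_nonpos hy.2, abs_of_nonpos h]; linarith [hy.1]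
    have b1 := intervalIntegral.norm_integral_le_of_norm_le_const (a := 0) (b := c) (f := fun y : ℝ => g (-T + y * I)) (C := C * Real.exp (-ε * |T|))
      (fun y h => by simpa using hb (-T) y (hy y h))
    have b2 := intervalIntegral.norm_integral_le_of_norm_le_const (a := 0) (b := c) (f := fun y : ℝ => g (T + y * I)) (C := C * Real.exp (-ε * |T|))
      (fun y h => by simpa using hb (T) y (hy y h))
    refine (norm_sub_le _ _).trans ?_
    simp only [norm_mul, norm_I, one_mul, sub_zero] at *
    linarith
  have tz : Filter.Tendsto (fun T : ℝ => (2 * C * |c|) * Real.exp (-ε * |T|)) Filter.atTop (nhds 0) := by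
    rw [← mul_zero (2 * C * |c|)]
    refine Filter.Tendsto.const_mul _ (Real.tendsto_exp_atBot.comp ?_)
    exact (Filter.tendsto_abs_atTop_atTop).const_mul_atTop_of_neg (neg_lt_zero.mpr hε)
  have := squeeze_zero_norm key tz
  exact sub_eq_zero.1 (tendsto_nhds_unique (t0.sub tc) this)

noncomputable def hh (z p : ℂ) : ℂ :=
  ∫ x in Ioi (0:ℝ), Complex.sin (z * x) * Complex.exp (-(x:ℂ)^2 / 2) * Complex.exp (-p * x)

theorem norm_sin_le' (w : ℂ) : ‖Complex.sin w‖ ≤ Real.exp ‖w‖ := by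
  have h1 := Complex.norm_exp_le_exp_norm (-w * I)
  have h2 := Complex.norm_exp_le_exp_norm (w * I)
  simp only [norm_mul, norm_neg, norm_I, mul_one] at h1 h2
  have h3 := norm_sub_le (Complex.exp (-w * I)) (Complex.exp (w * I))
  rw [Complex.sin]
  simp only [norm_mul, norm_div, norm_I, mul_one, Complex.norm_ofNat]
  linarith

theorem norm_cos_le' (w : ℂ) : ‖Complex.cos w‖ ≤ Real.exp ‖w‖ := by
  have h1 := Complex.norm_exp_le_exp_norm (-w * I)
  have h2 := Complex.norm_exp_le_exp_norm (w * I)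
  simp only [norm_mul, norm_neg, norm_I, mul_one] at h1 h2
  have h3 := norm_add_le (Complex.exp (w * I)) (Complex.exp (-w * I))
  rw [Complex.cos]
  simp only [norm_div, Complex.norm_ofNat]
  linarith

theorem norm_gauss (x : ℝ) : ‖Complex.exp (-(x:ℂ)^2 / 2)‖ = Real.exp (-x^2/2) := by
  rw [Complex.norm_exp]; congr 1
  have : (-(x:ℂ)^2/2) = ((-x^2/2 : ℝ) : ℂ) := by push_cast; ring
  rw [this, ofReal_re]

theorem norm_sin_real (z : ℂ) {x : ℝ} (hx : 0 ≤ x) : ‖Complex.sin (z * x)‖ ≤ Real.exp (‖z‖ * x) := by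
  refine (norm_sin_le' _).trans ?_
  simp [abs_of_nonneg hx]

theorem norm_cos_real (z : ℂ) {x : ℝ} (hx : 0 ≤ x) : ‖Complex.cos (z * x)‖ ≤ Real.exp (‖z‖ * x) := by
  refine (norm_cos_le' _).trans ?_
  simp [abs_of_nonneg hx]

theorem norm_exp_real (p : ℂ) {x : ℝ} : ‖Complex.exp (-p * x)‖ = Real.exp (-p.re * x) := by
  rw [Complex.norm_exp]; congr 1; simp

theorem norm_q (z : ℂ) {x : ℝ} (hx : 0 ≤ x) :
    ‖Complex.sin (z * x) * Complex.exp (-(x:ℂ)^2 / 2)‖ ≤ Real.exp (‖z‖ * x - x^2/2) := by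
  rw [norm_mul, norm_gauss, sub_eq_add_neg, Real.exp_add, neg_div]
  gcongr
  exact norm_sin_real z hx

theorem norm_qp (z p : ℂ) {x c : ℝ} (hx : 0 ≤ x) (hc : -p.re ≤ c) :
    ‖Complex.sin (z * x) * Complex.exp (-(x:ℂ)^2 / 2) * Complex.exp (-p * x)‖
      ≤ Real.exp ((‖z‖ + c) * x - x^2/2) := by
  rw [norm_mul, norm_exp_real]
  have : (‖z‖ + c) * x - x^2/2 = (‖z‖ * x - x^2/2) + c * x := by ring
  rw [this, Real.exp_add]
  gcongr
  exact norm_q z hx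

theorem gauss_int0 (c : ℝ) :
    IntegrableOn (fun x : ℝ => Real.exp (c * x - x^2/2)) (Ioi 0) := by
  simpa using gauss_int (κ := 0) (by norm_num) c

theorem gauss_int1 (c : ℝ) :
    IntegrableOn (fun x : ℝ => x * Real.exp (c * x - x^2/2)) (Ioi 0) := by
  simpa using gauss_int (κ := 1) (by norm_num) c

theorem qp_integrable (z p : ℂ) : IntegrableOn (fun x : ℝ => Complex.sin (z * x) * Complex.exp (-(x:ℂ)^2 / 2) * Complex.exp (-p * x)) (Ioi 0) := by
  refine Integrable.mono' (gauss_int0 (‖z‖ + -p.re)) (Continuous.aestronglyMeasurable (by fun_prop)) ?_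
  refine (ae_restrict_iff' measurableSet_Ioi).2 (Filter.Eventually.of_forall fun x hx => ?_)
  exact norm_qp z p (le_of_lt hx) le_rfl

theorem hh_diff (z : ℂ) : Differentiable ℂ (hh z) := by
  intro p
  have := hasDerivAt_integral_of_dominated_loc_of_deriv_le (𝕜 := ℂ) (μ := volume.restrict (Ioi (0:ℝ)))
    (F := fun (p : ℂ) (x : ℝ) => Complex.sin (z * x) * Complex.exp (-(x:ℂ)^2 / 2) * Complex.exp (-p * x))
    (F' := fun (p : ℂ) (x : ℝ) => Complex.sin (z * x) * Complex.exp (-(x:ℂ)^2 / 2) * Complex.exp (-p * x) * (-x))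
    (x₀ := p) (s := Metric.ball p 1) (bound := fun x => x * Real.exp ((‖z‖ + (‖p‖ + 1)) * x - x^2/2))
    (Metric.ball_mem_nhds _ one_pos)
    (Filter.Eventually.of_forall fun p => Continuous.aestronglyMeasurable (by fun_prop))
    (qp_integrable z p)
    (Continuous.aestronglyMeasurable (by fun_prop))
    ((ae_restrict_iff' measurableSet_Ioi).2 (Filter.Eventually.of_forall fun x hx w hw => by
      have hx : 0 < x := hx
      rw [norm_mul, mul_comm]
      have e : ‖(-x : ℂ)‖ = x := by simp [abs_of_pos hx]
      rw [e]
      gcongr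
      refine norm_qp z w hx.le ?_
      have h1 : ‖w‖ ≤ ‖p‖ + 1 := by
        have := norm_sub_norm_le w p
        rw [Metric.mem_ball, dist_eq_norm] at hw
        linarith
      have := Complex.abs_re_le_norm w
      have := neg_abs_le w.re
      linarith))
    (gauss_int1 _)
    (Filter.Eventually.of_forall fun x w hw => by
      have h1 : HasDerivAt (fun w : ℂ => -w * (x:ℂ)) (-(x:ℂ)) w := by
        simpa using ((hasDerivAt_id w).neg.mul_const (x:ℂ))
      have := (h1.cexp).const_mul (Complex.sin (z * x) * Complex.exp (-(x:ℂ)^2 / 2))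
      simpa [mul_assoc] using this)
  exact this.2.differentiableAt

theorem gauss_tendsto (c : ℝ) : Filter.Tendsto (fun x : ℝ => Real.exp (c * x - x^2/2)) Filter.atTop (nhds 0) := by
  refine Real.tendsto_exp_atBot.comp ?_
  have : (fun x : ℝ => c * x - x^2/2) = fun x => x * (c - x / 2) := by ext; ring
  rw [this]
  refine Filter.Tendsto.atTop_mul_atBot₀ Filter.tendsto_id ?_
  have := Filter.tendsto_atBot_add_const_left Filter.atTop c (Filter.tendsto_neg_atTop_atBot.comp (Filter.tendsto_id.atTop_div_const (two_pos (α := ℝ))))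
  simpa [sub_eq_add_neg] using this

theorem norm_r (z p : ℂ) {x c : ℝ} (hx : 0 ≤ x) (hc : -p.re ≤ c) :
    ‖(z * Complex.cos (z * x) - x * Complex.sin (z * x)) * Complex.exp (-(x:ℂ)^2 / 2) * Complex.exp (-p * x)‖
      ≤ ‖z‖ * Real.exp ((‖z‖ + c) * x - x^2/2) + x * Real.exp ((‖z‖ + c) * x - x^2/2) := by
  rw [norm_mul, norm_mul, norm_exp_real, norm_gauss]
  have : (‖z‖ + c) * x - x^2/2 = ‖z‖ * x + -x^2/2 + c * x := by ring
  rw [this, Real.exp_add, Real.exp_add, ← add_mul]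
  have h1 : ‖(z * Complex.cos (z * x) - x * Complex.sin (z * x))‖ ≤ (‖z‖ + x) * Real.exp (‖z‖ * x) := by
    refine (norm_sub_le _ _).trans ?_
    rw [norm_mul, norm_mul, add_mul]
    have e : ‖(x : ℂ)‖ = x := by simp [abs_of_nonneg hx]
    rw [e]
    gcongr
    · exact norm_cos_real z hx
    · exact norm_sin_real z hx
  calc _ ≤ ((‖z‖ + x) * Real.exp (‖z‖ * x)) * Real.exp (-x^2/2) * Real.exp (c * x) := by gcongr
    _ = _ := by ring

theorem r_integrable (z p : ℂ) : IntegrableOn (fun x : ℝ => (z * Complex.cos (z * x) - x * Complex.sin (z * x)) * Complex.exp (-(x:ℂ)^2 / 2) * Complex.exp (-p * x)) (Ioi 0) := by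
  refine Integrable.mono' (((gauss_int0 (‖z‖ + -p.re)).const_mul ‖z‖).add (gauss_int1 (‖z‖ + -p.re))) (Continuous.aestronglyMeasurable (by fun_prop)) ?_
  refine (ae_restrict_iff' measurableSet_Ioi).2 (Filter.Eventually.of_forall fun x hx => ?_)
  exact norm_r z p (le_of_lt hx) le_rfl

theorem hh_parts (z p : ℂ) : p * hh z p = ∫ x in Ioi (0:ℝ), (z * Complex.cos (z * x) - x * Complex.sin (z * x)) * Complex.exp (-(x:ℂ)^2 / 2) * Complex.exp (-p * x) := by
  have h := integral_Ioi_of_hasDerivAt_of_tendsto' (a := (0:ℝ)) (m := (0:ℂ))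
    (f := fun x : ℝ => Complex.sin (z * x) * Complex.exp (-(x:ℂ)^2 / 2) * Complex.exp (-p * x))
    (f' := fun x : ℝ => (z * Complex.cos (z * x) - x * Complex.sin (z * x)) * Complex.exp (-(x:ℂ)^2 / 2) * Complex.exp (-p * x)
      - p * (Complex.sin (z * x) * Complex.exp (-(x:ℂ)^2 / 2) * Complex.exp (-p * x)))
    (fun x _ => by
      have h1 : HasDerivAt (fun w : ℂ => z * w) z (x:ℂ) := by simpa using (hasDerivAt_id (x:ℂ)).const_mul z
      have h2 : HasDerivAt (fun w : ℂ => -p * w) (-p) (x:ℂ) := by simpa using (hasDerivAt_id (x:ℂ)).const_mul (-p)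
      have h3 : HasDerivAt (fun w : ℂ => -w^2/2) (-(x:ℂ)) (x:ℂ) := by
        have := ((hasDerivAt_pow 2 (x:ℂ)).neg).div_const 2
        refine this.congr_deriv ?_
        simp; ring
      have := ((h1.csin.mul h3.cexp).mul h2.cexp).comp_ofReal
      refine this.congr_deriv ?_
      simp only [Pi.mul_apply]
      ring)
    ((r_integrable z p).sub ((qp_integrable z p).const_mul p))
    (by
      refine squeeze_zero_norm' ?_ (gauss_tendsto (‖z‖ + -p.re))
      filter_upwards [Filter.eventually_ge_atTop 0] with x hx
      exact norm_qp z p hx le_rfl)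
  rw [integral_sub (r_integrable z p) ((qp_integrable z p).const_mul p), integral_const_mul] at h
  simp only [ofReal_zero, mul_zero, Complex.sin_zero, zero_mul, sub_zero] at h
  rw [hh]
  exact (sub_eq_zero.1 h).symm

theorem hh_bound (z : ℂ) : ∃ M : ℝ, 0 ≤ M ∧ ∀ p : ℂ, 0 ≤ p.re → ‖hh z p‖ * (1 + ‖p‖) ≤ M := by
  refine ⟨(∫ x in Ioi (0:ℝ), Real.exp ((‖z‖ + 0) * x - x^2/2)) + ∫ x in Ioi (0:ℝ), (‖z‖ * Real.exp ((‖z‖ + 0) * x - x^2/2) + x * Real.exp ((‖z‖ + 0) * x - x^2/2)), ?_, ?_⟩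
  · refine add_nonneg (setIntegral_nonneg measurableSet_Ioi fun x _ => by positivity) (setIntegral_nonneg measurableSet_Ioi fun x hx => ?_)
    have : (0:ℝ) < x := hx
    positivity
  intro p hp
  have h1 : ‖hh z p‖ ≤ ∫ x in Ioi (0:ℝ), Real.exp ((‖z‖ + 0) * x - x^2/2) := by
    refine norm_integral_le_of_norm_le (gauss_int0 _) ?_
    refine (ae_restrict_iff' measurableSet_Ioi).2 (Filter.Eventually.of_forall fun x hx => ?_)
    exact norm_qp z p (le_of_lt hx) (by linarith)
  have h2 : ‖p * hh z p‖ ≤ ∫ x in Ioi (0:ℝ), (‖z‖ * Real.exp ((‖z‖ + 0) * x - x^2/2) + x * Real.exp ((‖z‖ + 0) * x - x^2/2)) := by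
    rw [hh_parts]
    refine norm_integral_le_of_norm_le (((gauss_int0 _).const_mul ‖z‖).add (gauss_int1 _)) ?_
    refine (ae_restrict_iff' measurableSet_Ioi).2 (Filter.Eventually.of_forall fun x hx => ?_)
    exact norm_r z p (le_of_lt hx) (by linarith)
  rw [norm_mul] at h2
  linarith

theorem hh_gauss (z : ℂ) (r : ℝ) : hh z (-(I * r)) - hh z (I * r) =
    I * (Real.sqrt (2 * Real.pi) : ℝ) * (Complex.exp (-z^2/2) * (Complex.exp (z * r) - Complex.exp (-z * r)) / 2 * Complex.exp (-(r:ℂ)^2/2)) := by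
  have e1 : hh z (-(I * r)) - hh z (I * r) = ∫ x in Ioi (0:ℝ), Complex.sin (z * x) * Complex.exp (-(x:ℂ)^2 / 2) * (2 * I * Complex.sin (r * x)) := by
    rw [hh, hh, ← integral_sub (qp_integrable _ _) (qp_integrable _ _)]
    congr 1; ext x
    have a0 : Complex.sin (r * x) = (Complex.exp (-(r * x) * I) - Complex.exp (r * x * I)) * I / 2 := rfl
    rw [a0]
    have a1 : -(-(I * (r:ℂ))) * (x:ℂ) = r * x * I := by ring
    have a2 : -(I * (r:ℂ)) * (x:ℂ) = -(r * x) * I := by ring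
    rw [a1, a2]
    linear_combination (Complex.sin (z * x) * Complex.exp (-(x:ℂ)^2 / 2)) * (Complex.exp (-(r * x) * I) - Complex.exp (r * x * I)) * (-1) * I_sq
  set F : ℝ → ℂ := fun x => Complex.sin (z * x) * Complex.exp (-(x:ℂ)^2 / 2) * (2 * I * Complex.sin (r * x)) with hF
  have G : ∀ t : ℂ, ∫ x : ℝ, Complex.exp (I * t * x) * Complex.exp (-(1/2 : ℂ) * x^2) = (Real.sqrt (2 * Real.pi) : ℝ) * Complex.exp (-t^2/2) := by
    intro t
    rw [fourierIntegral_gaussian (by norm_num)]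
    congr 1
    · rw [Real.sqrt_eq_rpow, Complex.ofReal_cpow (by positivity)]
      congr 1
      · push_cast; ring
      · norm_num
    · congr 1; ring
  have Gi : ∀ t : ℂ, Integrable (fun x : ℝ => Complex.exp (I * t * x) * Complex.exp (-(1/2 : ℂ) * x^2)) := by
    intro t
    have := integrable_cexp_quadratic (b := 1/2) (by norm_num) (I * t) 0
    refine this.congr (Filter.Eventually.of_forall fun x => ?_)
    simp only
    rw [← Complex.exp_add]; congr 1; ring
  have FE : F = fun x : ℝ => (I/2) * (Complex.exp (I * (z - r) * x) * Complex.exp (-(1/2 : ℂ) * x^2)) + (I/2) * (Complex.exp (I * (-(z - r)) * x) * Complex.exp (-(1/2 : ℂ) * x^2))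
      - (I/2) * (Complex.exp (I * (z + r) * x) * Complex.exp (-(1/2 : ℂ) * x^2)) - (I/2) * (Complex.exp (I * (-(z + r)) * x) * Complex.exp (-(1/2 : ℂ) * x^2)) := by
    ext x
    simp only [hF, Complex.sin]
    have b1 : I * (z - r) * x = z * x * I + -(r * x) * I := by ring
    have b2 : I * (-(z - r)) * x = -(z * x) * I + (r * x) * I := by ring
    have b3 : I * (z + r) * x = z * x * I + (r * x) * I := by ring
    have b4 : I * (-(z + r)) * x = -(z * x) * I + -(r * x) * I := by ring
    have b5 : -(x:ℂ)^2/2 = -(1/2 : ℂ) * x^2 := by ring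
    rw [b1, b2, b3, b4, b5, Complex.exp_add, Complex.exp_add, Complex.exp_add, Complex.exp_add]
    generalize Complex.exp (-(1/2 : ℂ) * x^2) = A
    generalize Complex.exp (z * x * I) = B
    generalize Complex.exp (-(z * x) * I) = C
    generalize Complex.exp (r * x * I) = D
    generalize Complex.exp (-(r * x) * I) = E
    linear_combination (C - B) * A * (E - D) * I / 2 * I_sq
  have Fi : Integrable F := by
    rw [FE]
    exact ((((Gi _).const_mul _).add ((Gi _).const_mul _)).sub ((Gi _).const_mul _)).sub ((Gi _).const_mul _)
  have i1 : ∫ x in Ioi (0:ℝ), F x = (1/2) * ∫ x, F x := by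
    rw [← intervalIntegral.integral_Iic_add_Ioi (b := 0) Fi.integrableOn Fi.integrableOn]
    have : ∫ x in Iic (0:ℝ), F x = ∫ x in Ioi (0:ℝ), F x := by
      have := integral_comp_neg_Iic (0:ℝ) F
      rw [neg_zero] at this
      rw [← this]
      congr 1; ext x
      simp [hF]
    rw [this]; ring
  have I2 : ∀ a b : ℂ, Integrable (fun x : ℝ => (I/2) * (Complex.exp (I * a * x) * Complex.exp (-(1/2 : ℂ) * x^2)) + (I/2) * (Complex.exp (I * b * x) * Complex.exp (-(1/2 : ℂ) * x^2))) :=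
    fun a b => ((Gi a).const_mul _).add ((Gi b).const_mul _)
  have I3 : ∀ a b c : ℂ, Integrable (fun x : ℝ => (I/2) * (Complex.exp (I * a * x) * Complex.exp (-(1/2 : ℂ) * x^2)) + (I/2) * (Complex.exp (I * b * x) * Complex.exp (-(1/2 : ℂ) * x^2)) - (I/2) * (Complex.exp (I * c * x) * Complex.exp (-(1/2 : ℂ) * x^2))) :=
    fun a b c => (I2 a b).sub ((Gi c).const_mul _)
  rw [e1, i1, FE, integral_sub (I3 _ _ _) ((Gi _).const_mul _),
    integral_sub (I2 _ _) ((Gi _).const_mul _),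
    integral_add ((Gi _).const_mul _) ((Gi _).const_mul _)]
  simp only [integral_const_mul, G]
  have c1 : -(z - r)^2/2 = -z^2/2 + z * r + -(r:ℂ)^2/2 := by ring
  have c2 : -(-(z - r))^2/2 = -z^2/2 + z * r + -(r:ℂ)^2/2 := by ring
  have c3 : -(z + r)^2/2 = -z^2/2 + -z * r + -(r:ℂ)^2/2 := by ring
  have c4 : -(-(z + r))^2/2 = -z^2/2 + -z * r + -(r:ℂ)^2/2 := by ring
  rw [c1, c2, c3, c4]
  simp only [Complex.exp_add]
  ring

theorem cosh_norm_lower (x y : ℝ) : Real.exp |x| - 1 ≤ 2 * ‖Complex.cosh (x + y * I)‖ := by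
  have e : 2 * ‖Complex.cosh (x + y * I)‖ = ‖Complex.exp (x + y * I) + Complex.exp (-(x + y * I))‖ := by
    rw [Complex.cosh, norm_div, Complex.norm_ofNat]; ring
  have n1 : ‖Complex.exp (x + y * I)‖ = Real.exp x := by rw [Complex.norm_exp]; simp
  have n2 : ‖Complex.exp (-(x + y * I))‖ = Real.exp (-x) := by rw [Complex.norm_exp]; simp
  rw [e]
  rcases le_total 0 x with h | h
  · rw [abs_of_nonneg h]
    have := norm_sub_le_norm_add (Complex.exp (x + y * I)) (Complex.exp (-(x + y * I)))
    rw [n1, n2] at this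
    have : Real.exp (-x) ≤ 1 := Real.exp_le_one_iff.2 (by linarith)
    linarith
  · rw [abs_of_nonpos h, add_comm]
    have := norm_sub_le_norm_add (Complex.exp (-(x + y * I))) (Complex.exp (x + y * I))
    rw [n1, n2] at this
    have : Real.exp (x) ≤ 1 := Real.exp_le_one_iff.2 (by linarith)
    linarith

theorem g_shift (z β : ℂ) (hβ : |β.re| < 1) {ρ : ℝ} (hρ : 0 < ρ) (c : ℝ) (hc : |c| ≤ Real.pi / 2) :
    ∫ x : ℝ, Complex.exp (x * β) * hh z (2 * ρ * Complex.cosh x) =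
    ∫ x : ℝ, Complex.exp ((x + c * I) * β) * hh z (2 * ρ * Complex.cosh (x + c * I)) := by
  obtain ⟨M, hM, hb⟩ := hh_bound z
  have hm : 0 < min 1 ρ := lt_min one_pos hρ
  refine strip_shift (fun w => Complex.exp (w * β) * hh z (2 * ρ * Complex.cosh w)) ?_ c
    (Real.exp (Real.pi / 2 * |β.im|) * (M / min 1 ρ)) (1 - |β.re|) (by linarith) ?_
  · have h1 := hh_diff z
    have h2 : Differentiable ℂ (fun w : ℂ => 2 * ρ * Complex.cosh w) := by fun_prop
    exact (by fun_prop : Differentiable ℂ (fun w : ℂ => Complex.exp (w * β))).mul (h1.comp h2)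
  · intro x y hy
    have hy' : |y| ≤ Real.pi / 2 := hy.trans hc
    simp only [norm_mul]
    have hp : 0 ≤ (2 * ρ * Complex.cosh (x + y * I)).re := by
      have : (2 * ρ * Complex.cosh (x + y * I)).re = 2 * ρ * (Real.cosh x * Real.cos y) := by
        rw [Complex.cosh_add, Complex.cosh_mul_I, Complex.sinh_mul_I, ← ofReal_cosh, ← ofReal_cos, ← ofReal_sinh, ← ofReal_sin]
        simp [-ofReal_cos, -ofReal_sin, -ofReal_cosh, -ofReal_sinh]
      rw [this]
      have := Real.cos_nonneg_of_mem_Icc (x := y) ⟨by linarith [(abs_le.1 hy').1], (abs_le.1 hy').2⟩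
      have := Real.cosh_pos x
      positivity
    have h1 := hb _ hp
    have h2 : min 1 ρ * Real.exp |x| ≤ 1 + ‖2 * ρ * Complex.cosh (x + y * I)‖ := by
      have e : ‖2 * ρ * Complex.cosh (x + y * I)‖ = ρ * (2 * ‖Complex.cosh (x + y * I)‖) := by
        simp [abs_of_pos hρ]; ring
      rw [e]
      have := cosh_norm_lower x y
      have h3 : 0 ≤ Real.exp |x| - 1 := by linarith [Real.one_le_exp (abs_nonneg x)]
      calc min 1 ρ * Real.exp |x| = min 1 ρ + min 1 ρ * (Real.exp |x| - 1) := by ring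
        _ ≤ 1 + ρ * (Real.exp |x| - 1) := by gcongr <;> simp
        _ ≤ _ := by gcongr
    have h4 : ‖hh z (2 * ρ * Complex.cosh (x + y * I))‖ ≤ M / min 1 ρ * Real.exp (-|x|) := by
      rw [Real.exp_neg, ← div_eq_mul_inv, div_div, le_div_iff₀ (by positivity)]
      refine le_trans ?_ h1
      gcongr
    have h5 : ‖Complex.exp ((x + y * I) * β)‖ ≤ Real.exp (Real.pi / 2 * |β.im|) * Real.exp (|β.re| * |x|) := by
      rw [Complex.norm_exp, ← Real.exp_add]
      apply Real.exp_le_exp.2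
      have e : ((x + y * I) * β).re = x * β.re - y * β.im := by simp
      rw [e]
      have a1 : x * β.re ≤ |β.re| * |x| := by rw [← abs_mul, mul_comm]; exact le_abs_self _
      have a2 : -(y * β.im) ≤ Real.pi / 2 * |β.im| := by
        calc -(y * β.im) ≤ |y * β.im| := neg_le_abs _
          _ = |y| * |β.im| := abs_mul _ _
          _ ≤ _ := by gcongr
      linarith
    calc _ ≤ (Real.exp (Real.pi / 2 * |β.im|) * Real.exp (|β.re| * |x|)) * (M / min 1 ρ * Real.exp (-|x|)) := by gcongr
      _ = _ := by
        have : -(1 - |β.re|) * |x| = |β.re| * |x| + -|x| := by ring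
        rw [this, Real.exp_add]; ring

theorem g_integrable (z β : ℂ) (hβ : |β.re| < 1) {ρ : ℝ} (hρ : 0 < ρ) (σ : ℂ) (hσ : σ = I ∨ σ = -I) :
    Integrable fun x : ℝ => Complex.exp (x * β) * hh z (σ * (2 * ρ * Real.sinh x : ℝ)) := by
  obtain ⟨M, hM, hb⟩ := hh_bound z
  have hm : 0 < min 1 ρ := lt_min one_pos hρ
  have hd := (hh_diff z).continuous
  refine Integrable.mono' ((exp_abs_integrable (ε := 1 - |β.re|) (by linarith)).const_mul (M / min 1 ρ))
    (Continuous.aestronglyMeasurable ?_) (Filter.Eventually.of_forall fun x => ?_)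
  · have : Continuous fun x : ℝ => σ * (2 * ρ * Real.sinh x : ℝ) := by
      have := Real.continuous_sinh
      fun_prop
    exact (by fun_prop : Continuous fun x : ℝ => Complex.exp (x * β)).mul (hd.comp this)
  · have hre : (σ * (2 * ρ * Real.sinh x : ℝ)).re = 0 := by
      rcases hσ with rfl | rfl <;> simp
    have hns : ‖σ‖ = 1 := by rcases hσ with rfl | rfl <;> simp
    have h1 := hb _ hre.ge
    have h2 : min 1 ρ * Real.exp |x| ≤ 1 + ‖σ * (2 * ρ * Real.sinh x : ℝ)‖ := by
      have e : ‖σ * (2 * ρ * Real.sinh x : ℝ)‖ = ρ * (2 * |Real.sinh x|) := by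
        rw [norm_mul, hns, Complex.norm_real, Real.norm_eq_abs, abs_mul, abs_mul, abs_of_pos hρ]
        simp; ring
      rw [e]
      have : Real.exp |x| - 1 ≤ 2 * |Real.sinh x| := by
        rw [Real.abs_sinh, Real.sinh_eq]
        have : Real.exp (-|x|) ≤ 1 := Real.exp_le_one_iff.2 (by linarith [abs_nonneg x])
        linarith
      have h3 : 0 ≤ Real.exp |x| - 1 := by linarith [Real.one_le_exp (abs_nonneg x)]
      calc min 1 ρ * Real.exp |x| = min 1 ρ + min 1 ρ * (Real.exp |x| - 1) := by ring
        _ ≤ 1 + ρ * (Real.exp |x| - 1) := by gcongr <;> simp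
        _ ≤ _ := by gcongr
    have h4 : ‖hh z (σ * (2 * ρ * Real.sinh x : ℝ))‖ ≤ M / min 1 ρ * Real.exp (-|x|) := by
      rw [Real.exp_neg, ← div_eq_mul_inv, div_div, le_div_iff₀ (by positivity)]
      refine le_trans ?_ h1
      gcongr
    have h5 : ‖Complex.exp (x * β)‖ ≤ Real.exp (|β.re| * |x|) := by
      rw [Complex.norm_exp]
      apply Real.exp_le_exp.2
      have e : (x * β).re = x * β.re := by simp
      rw [e, ← abs_mul, mul_comm]; exact le_abs_self _
    rw [norm_mul]
    calc _ ≤ (Real.exp (|β.re| * |x|)) * (M / min 1 ρ * Real.exp (-|x|)) := by gcongr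
      _ = _ := by
        have : -(1 - |β.re|) * |x| = |β.re| * |x| + -|x| := by ring
        rw [this, Real.exp_add]; ring

theorem inner_id (z μ : ℂ) (hμ0 : 0 < μ.re) (hμ2 : μ.re < 2) {ρ : ℝ} (hρ : 0 < ρ) :
    Complex.cos ((Real.pi : ℂ) * μ / 2) * ∫ x : ℝ, Complex.exp (x * (1 - μ)) * hh z (2 * ρ * Complex.cosh x) =
    (Real.sqrt (2 * Real.pi) : ℝ) / 4 * Complex.exp (-z^2/2) * ∫ x : ℝ, Complex.exp (x * (1 - μ)) *
      ((Complex.exp (z * (2 * ρ * Real.sinh x : ℝ)) - Complex.exp (-z * (2 * ρ * Real.sinh x : ℝ)))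
        * Complex.exp (-((2 * ρ * Real.sinh x : ℝ):ℂ)^2/2)) := by
  have hβ : |(1 - μ).re| < 1 := by
    rw [abs_lt]; simp only [sub_re, one_re]; constructor <;> linarith
  have pp := Real.pi_pos
  have s1 := g_shift z (1 - μ) hβ hρ (Real.pi / 2) (by rw [abs_of_pos (by positivity)])
  have s2 := g_shift z (1 - μ) hβ hρ (-(Real.pi / 2)) (by rw [abs_neg, abs_of_pos (by positivity)])
  have e1 : ∀ x : ℝ, Complex.exp ((x + (Real.pi / 2 : ℝ) * I) * (1 - μ)) * hh z (2 * ρ * Complex.cosh (x + (Real.pi / 2 : ℝ) * I))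
     = Complex.exp (Real.pi / 2 * I * (1 - μ)) * (Complex.exp (x * (1 - μ)) * hh z (I * (2 * ρ * Real.sinh x : ℝ))) := by
    intro x
    have a : 2 * ρ * Complex.cosh (x + (Real.pi / 2 : ℝ) * I) = I * (2 * ρ * Real.sinh x : ℝ) := by
      rw [Complex.cosh_add, Complex.cosh_mul_I, Complex.sinh_mul_I, ← ofReal_cos, ← ofReal_sin]
      simp; ring
    rw [a, add_mul, Complex.exp_add]; push_cast; ring
  have e2 : ∀ x : ℝ, Complex.exp ((x + (-(Real.pi / 2) : ℝ) * I) * (1 - μ)) * hh z (2 * ρ * Complex.cosh (x + (-(Real.pi / 2) : ℝ) * I))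
     = Complex.exp (-(Real.pi / 2 * I * (1 - μ))) * (Complex.exp (x * (1 - μ)) * hh z (-I * (2 * ρ * Real.sinh x : ℝ))) := by
    intro x
    have a : 2 * ρ * Complex.cosh (x + (-(Real.pi / 2) : ℝ) * I) = -I * (2 * ρ * Real.sinh x : ℝ) := by
      rw [Complex.cosh_add, Complex.cosh_mul_I, Complex.sinh_mul_I, ← ofReal_cos, ← ofReal_sin]
      simp; ring
    rw [a, add_mul, Complex.exp_add]; push_cast; ring_nf
  simp only [e1, integral_const_mul] at s1
  simp only [e2, integral_const_mul] at s2
  have d := integral_sub (g_integrable z (1 - μ) hβ hρ (-I) (Or.inr rfl)) (g_integrable z (1 - μ) hβ hρ I (Or.inl rfl))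
  have d2 : ∀ x : ℝ, Complex.exp (x * (1 - μ)) * hh z (-I * (2 * ρ * Real.sinh x : ℝ)) - Complex.exp (x * (1 - μ)) * hh z (I * (2 * ρ * Real.sinh x : ℝ))
     = (I * (Real.sqrt (2 * Real.pi) : ℝ) * Complex.exp (-z^2/2) / 2) * (Complex.exp (x * (1 - μ)) *
      ((Complex.exp (z * (2 * ρ * Real.sinh x : ℝ)) - Complex.exp (-z * (2 * ρ * Real.sinh x : ℝ)))
        * Complex.exp (-((2 * ρ * Real.sinh x : ℝ):ℂ)^2/2))) := by
    intro x
    rw [← mul_sub, neg_mul, hh_gauss]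
    ring
  simp only [d2, integral_const_mul] at d
  generalize (∫ x : ℝ, Complex.exp (x * (1 - μ)) *
      ((Complex.exp (z * (2 * ρ * Real.sinh x : ℝ)) - Complex.exp (-z * (2 * ρ * Real.sinh x : ℝ)))
        * Complex.exp (-((2 * ρ * Real.sinh x : ℝ):ℂ)^2/2))) = G at *
  generalize (∫ x : ℝ, Complex.exp (x * (1 - μ)) * hh z (2 * ρ * Complex.cosh x)) = B at *
  generalize (∫ x : ℝ, Complex.exp (x * (1 - μ)) * hh z (I * (2 * ρ * Real.sinh x : ℝ))) = K1 at *
  generalize (∫ x : ℝ, Complex.exp (x * (1 - μ)) * hh z (-I * (2 * ρ * Real.sinh x : ℝ))) = K2 at *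
  have hc : Complex.cos ((Real.pi : ℂ) * μ / 2) = (Complex.exp (-(Real.pi / 2 * I * (1 - μ))) - Complex.exp (Real.pi / 2 * I * (1 - μ))) * I / 2 := by
    have : (Real.pi : ℂ) * μ / 2 = Real.pi / 2 - Real.pi / 2 * (1 - μ) := by ring
    rw [this, Complex.cos_pi_div_two_sub, Complex.sin]
    ring_nf
  have hE : Complex.exp (-(Real.pi / 2 * I * (1 - μ))) * Complex.exp (Real.pi / 2 * I * (1 - μ)) = 1 := by
    rw [← Complex.exp_add]; simp
  rw [hc]
  generalize Complex.exp (-(Real.pi / 2 * I * (1 - μ))) = E at *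
  generalize Complex.exp (Real.pi / 2 * I * (1 - μ)) = E' at *
  have k1 : E * B = K1 := by rw [s1]; linear_combination K1 * hE
  have k2 : E' * B = K2 := by rw [s2]; linear_combination K2 * hE
  linear_combination (I/2) * k1 - (I/2) * k2 + (I/2) * d - (Real.sqrt (2 * Real.pi) : ℝ) * Complex.exp (-z^2/2) * G / 4 * I_sq

theorem covP_integral (f : ℝ × ℝ → ℂ) :
    ∫ p, f p ∂((volume.restrict (Ioi (0:ℝ))).prod (volume.restrict (Ioi (0:ℝ)))) =
    ∫ p : ℝ × ℝ, (2 * p.1 : ℂ) * f (covM p) ∂((volume.restrict (Ioi (0:ℝ))).prod volume) := by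
  have := cov_integral f
  rwa [Measure.volume_eq_prod, ← Measure.prod_restrict, ← Measure.prod_restrict, Measure.restrict_univ] at this

theorem covP_integrable (f : ℝ × ℝ → ℂ) (hf : Integrable f ((volume.restrict (Ioi (0:ℝ))).prod (volume.restrict (Ioi (0:ℝ))))) :
    Integrable (fun p : ℝ × ℝ => (2 * p.1 : ℂ) * f (covM p)) ((volume.restrict (Ioi (0:ℝ))).prod volume) := by
  have := cov_integrable f
  rw [IntegrableOn, IntegrableOn, Measure.volume_eq_prod, ← Measure.prod_restrict, ← Measure.prod_restrict, Measure.restrict_univ] at this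
  exact this hf

theorem cpw {a : ℝ} (ha : 0 < a) (w : ℂ) : (a:ℂ) ^ w = Complex.exp ((Real.log a : ℝ) * w) := by
  rw [Complex.cpow_def_of_ne_zero (by exact_mod_cast ha.ne'), Complex.ofReal_log ha.le]

theorem norm_cpw {a : ℝ} (ha : 0 < a) (w : ℂ) : ‖(a:ℂ) ^ w‖ = a ^ w.re := by
  rw [Complex.norm_cpow_eq_rpow_re_of_pos ha]

/-- the weight in the new coordinates -/
noncomputable def WW (ν μ : ℂ) (p : ℝ × ℝ) : ℂ :=
  2 * ((p.1 : ℂ) ^ (2 * ν - μ) * Complex.exp (-(p.1:ℂ)^2)) * Complex.exp (p.2 * (1 - μ))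

theorem weight_eq (ν μ : ℂ) {p : ℝ × ℝ} (hp : 0 < p.1) :
    (2 * p.1 : ℂ) * (((covM p).1 : ℂ) ^ (ν - 1) * ((covM p).2 : ℂ) ^ (ν - μ)) =
      2 * (p.1 : ℂ) ^ (2 * ν - μ) * Complex.exp (p.2 * (1 - μ)) := by
  simp only [covM]
  rw [cpw (by positivity), cpw (by positivity), cpw hp, Real.log_mul hp.ne' (Real.exp_pos _).ne', Real.log_mul hp.ne' (Real.exp_pos _).ne',
    Real.log_exp, Real.log_exp]
  have : (p.1 : ℂ) = Complex.exp (Real.log p.1 : ℝ) := by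
    rw [← ofReal_exp, Real.exp_log hp]
  conv_lhs => rw [this]
  rw [mul_assoc, ← Complex.exp_add, ← Complex.exp_add, mul_assoc 2, ← Complex.exp_add]
  congr 2; push_cast; ring

theorem WW_norm (ν μ : ℂ) {p : ℝ × ℝ} (hp : 0 < p.1) :
    ‖WW ν μ p‖ = 2 * (p.1 ^ (2 * ν - μ).re * Real.exp (-p.1^2)) * Real.exp (p.2 * (1 - μ.re)) := by
  rw [WW, norm_mul, norm_mul, norm_mul, norm_cpw hp, Complex.norm_exp, Complex.norm_exp]
  congr 3
  · simp
  · congr 1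
    rw [← ofReal_pow, ← ofReal_neg, ofReal_re]
  · simp

theorem WW_meas (ν μ : ℂ) : Measurable (WW ν μ) := by
  unfold WW
  fun_prop

theorem ae_Q {P : ℝ × ℝ → Prop} (h : ∀ p : ℝ × ℝ, 0 < p.1 → P p) :
    ∀ᵐ p ∂((volume.restrict (Ioi (0:ℝ))).prod (volume : Measure ℝ)), P p := by
  have : (volume.restrict (Ioi (0:ℝ))).prod (volume : Measure ℝ) = (volume.prod volume).restrict (Ioi (0:ℝ) ×ˢ univ) := by
    rw [← Measure.prod_restrict, Measure.restrict_univ]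
  rw [this]
  refine (ae_restrict_iff' (measurableSet_Ioi.prod MeasurableSet.univ)).2 (Filter.Eventually.of_forall fun p hp => h p hp.1)

theorem ae_P {P : ℝ × ℝ → Prop} (h : ∀ p : ℝ × ℝ, 0 < p.1 → 0 < p.2 → P p) :
    ∀ᵐ p ∂((volume.restrict (Ioi (0:ℝ))).prod (volume.restrict (Ioi (0:ℝ)))), P p := by
  rw [Measure.prod_restrict]
  refine (ae_restrict_iff' (measurableSet_Ioi.prod measurableSet_Ioi)).2 (Filter.Eventually.of_forall fun p hp => h p hp.1 hp.2)

theorem cpow_exp_integrable {w : ℂ} (hw : -1 < w.re) {x : ℝ} (hx : 0 < x) :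
    IntegrableOn (fun t : ℝ => (t:ℂ) ^ w * Complex.exp (-(x:ℂ) * t)) (Ioi 0) := by
  have h0 : IntegrableOn (fun t : ℝ => t ^ w.re * Real.exp (-x * t)) (Ioi 0) :=
    integrableOn_rpow_mul_exp_neg_mul_rpow hw (p := 1) one_pos hx |>.congr_fun (fun t _ => by simp) measurableSet_Ioi
  refine Integrable.mono' h0 (Measurable.aestronglyMeasurable (by fun_prop)) ?_
  refine (ae_restrict_iff' measurableSet_Ioi).2 (Filter.Eventually.of_forall fun t ht => ?_)
  rw [norm_mul, norm_cpw ht, norm_exp_real, ofReal_re]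

theorem psi_double (ν μ : ℂ) (hν : 0 < ν.re) (hμν : μ.re < ν.re + 1) {x : ℝ} (hx : 0 < x) :
    Complex.Gamma (ν + 1 - μ) * ((x:ℂ) ^ (μ - 1) * ∫ u in Ioi (0:ℝ), Complex.exp (-(x:ℂ)^2 * u) * (u:ℂ) ^ (ν - 1) *
            ((1:ℂ) + (u:ℂ)) ^ (μ - ν - 1)) =
    ∫ p : ℝ × ℝ, WW ν μ p * Complex.exp (-(2 * p.1 * Complex.cosh p.2) * x) ∂((volume.restrict (Ioi (0:ℝ))).prod volume) := by
  set f : ℝ × ℝ → ℂ := fun p => ((p.1 : ℂ) ^ (ν - 1) * (p.2 : ℂ) ^ (ν - μ)) * Complex.exp (-(p.1 * p.2 + x * p.1 + x * p.2)) with hf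
  have fi : Integrable f ((volume.restrict (Ioi (0:ℝ))).prod (volume.restrict (Ioi (0:ℝ)))) := by
    have h1 := cpow_exp_integrable (w := ν - 1) (by simp; linarith) hx
    have h2 := cpow_exp_integrable (w := ν - μ) (by simp; linarith) hx
    refine Integrable.mono (Integrable.mul_prod h1 h2) (Measurable.aestronglyMeasurable (by fun_prop)) (ae_P fun p h1 h2 => ?_)
    have : f p = (((p.1 : ℂ) ^ (ν - 1) * Complex.exp (-(x:ℂ) * p.1)) * ((p.2 : ℂ) ^ (ν - μ) * Complex.exp (-(x:ℂ) * p.2))) * Complex.exp (-(p.1:ℂ) * p.2) := by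
      simp only [hf]
      have : -((p.1:ℂ) * p.2 + x * p.1 + x * p.2) = -(x:ℂ) * p.1 + -(x:ℂ) * p.2 + -(p.1:ℂ) * p.2 := by ring
      rw [this, Complex.exp_add, Complex.exp_add]; ring
    rw [this, norm_mul _ (Complex.exp (-(p.1:ℂ) * p.2)), norm_exp_real]
    refine mul_le_of_le_one_right (norm_nonneg _) (Real.exp_le_one_iff.2 ?_)
    simp only [ofReal_re, neg_mul]
    have := mul_pos h1 h2
    linarith
  have r : ∫ p, f p ∂((volume.restrict (Ioi (0:ℝ))).prod (volume.restrict (Ioi (0:ℝ)))) =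
    ∫ p : ℝ × ℝ, WW ν μ p * Complex.exp (-(2 * p.1 * Complex.cosh p.2) * x) ∂((volume.restrict (Ioi (0:ℝ))).prod volume) := by
    rw [covP_integral]
    refine integral_congr_ae (ae_Q fun p hp => ?_)
    simp only [hf]
    rw [← mul_assoc, weight_eq ν μ hp, WW]
    have : -((((covM p).1:ℝ):ℂ) * ((covM p).2:ℝ) + x * ((covM p).1:ℝ) + x * ((covM p).2:ℝ)) = -(p.1:ℂ)^2 + -(2 * p.1 * Complex.cosh p.2) * x := by
      simp only [covM, Complex.cosh]
      push_cast
      have : Complex.exp (-(p.2:ℂ)) * Complex.exp p.2 = 1 := by rw [← Complex.exp_add]; simp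
      linear_combination -(p.1:ℂ)^2 * this
    rw [this, Complex.exp_add]; ring
  rw [← r, integral_prod f fi]
  have inner : ∀ t ∈ Ioi (0:ℝ), ∫ s in Ioi (0:ℝ), f (t, s) = Complex.Gamma (ν + 1 - μ) * ((t:ℂ)^(ν - 1) * Complex.exp (-(x:ℂ) * t) * ((t + x : ℝ) : ℂ) ^ (μ - ν - 1)) := by
    intro t ht
    have ht : 0 < t := ht
    have h := integral_cpow_mul_exp_neg_mul_Ioi (a := ν + 1 - μ) (r := t + x) (by simp; linarith) (by positivity)
    have : ∀ s : ℝ, f (t, s) = ((t:ℂ)^(ν - 1) * Complex.exp (-(x:ℂ) * t)) * ((s:ℂ) ^ (ν + 1 - μ - 1) * Complex.exp (-((t + x : ℝ) * s))) := by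
      intro s
      simp only [hf]
      have e1 : -((t:ℂ) * s + x * t + x * s) = -(x:ℂ) * t + -((t + x : ℝ) * s) := by push_cast; ring
      have e2 : ν + 1 - μ - 1 = ν - μ := by ring
      rw [e1, e2, Complex.exp_add]; ring
    simp only [this]
    rw [integral_const_mul, ]
    have e3 : (1 / ((t + x : ℝ) : ℂ)) ^ (ν + 1 - μ) = ((t + x : ℝ) : ℂ) ^ (μ - ν - 1) := by
      have : (1 / ((t + x : ℝ) : ℂ)) = (((t + x)⁻¹ : ℝ) : ℂ) := by push_cast; simp
      rw [this, cpw (by positivity), cpw (by positivity), Real.log_inv]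
      congr 1; push_cast; ring
    have h' := h
    rw [e3] at h'
    rw [h']; ring
  rw [setIntegral_congr_fun measurableSet_Ioi inner, integral_const_mul]
  congr 1
  have sc := integral_comp_mul_left_Ioi (fun t : ℝ => (t:ℂ)^(ν - 1) * Complex.exp (-(x:ℂ) * t) * ((t + x : ℝ) : ℂ) ^ (μ - ν - 1)) 0 hx
  rw [mul_zero] at sc
  have sc' : ∫ t in Ioi (0:ℝ), (t:ℂ)^(ν - 1) * Complex.exp (-(x:ℂ) * t) * ((t + x : ℝ) : ℂ) ^ (μ - ν - 1) =
    (x:ℂ) * ∫ u in Ioi (0:ℝ), ((x * u : ℝ):ℂ)^(ν - 1) * Complex.exp (-(x:ℂ) * (x * u : ℝ)) * ((x * u + x : ℝ) : ℂ) ^ (μ - ν - 1) := by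
    rw [sc, Complex.real_smul, ← mul_assoc]
    have : (x:ℂ) ≠ 0 := by exact_mod_cast hx.ne'
    push_cast
    rw [mul_inv_cancel₀ this, one_mul]
  rw [sc', ← integral_const_mul, ← integral_const_mul]
  refine setIntegral_congr_fun measurableSet_Ioi fun u hu => ?_
  have hu : 0 < u := hu
  have e1 : (x * u + x : ℝ) = x * (1 + u) := by ring
  have e2 : (1:ℂ) + u = ((1 + u : ℝ) : ℂ) := by push_cast; ring
  have e3 : -(x:ℂ) * (x * u : ℝ) = -(x:ℂ)^2 * u := by push_cast; ring
  have e4 : (x:ℂ) ^ (μ - 1) = x * ((x:ℂ) ^ (ν - 1) * (x:ℂ) ^ (μ - ν - 1)) := by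
    have : (x : ℂ) = Complex.exp (Real.log x : ℝ) := by
      rw [← ofReal_exp, Real.exp_log hx]
    rw [cpw hx, cpw hx, cpw hx]
    conv_rhs => rw [this]
    rw [← Complex.exp_add, ← Complex.exp_add]; congr 1; ring
  rw [e1, e2, e3, e4, ofReal_mul x u, ofReal_mul x (1 + u), Complex.mul_cpow_ofReal_nonneg hx.le hu.le, Complex.mul_cpow_ofReal_nonneg hx.le (by positivity)]
  ring

theorem rpow_mul_exp_neg_le {y δ : ℝ} (hy : 0 < y) (h0 : 0 ≤ δ) (h1 : δ ≤ 1) : Real.exp (-y) ≤ y ^ (-δ) := by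
  rw [Real.rpow_neg hy.le, Real.exp_neg]
  apply inv_anti₀ (by positivity)
  have : y ^ δ ≤ 1 + y := by
    calc y ^ δ ≤ (1 + y) ^ δ := Real.rpow_le_rpow hy.le (by linarith) h0
      _ ≤ (1 + y) ^ (1:ℝ) := Real.rpow_le_rpow_of_exponent_le (by linarith) h1
      _ = _ := Real.rpow_one _
  linarith [Real.add_one_le_exp y]

theorem triple_integrable (ν μ z : ℂ) (hν : 0 < ν.re) (hμ0 : 0 < μ.re) (hμ2 : μ.re < 2)
    (hμν : μ.re < ν.re + 1) :
    Integrable (fun w : ℝ × (ℝ × ℝ) => Complex.sin (z * w.1) * Complex.exp (-(w.1:ℂ)^2 / 2) *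
        (WW ν μ w.2 * Complex.exp (-(2 * w.2.1 * Complex.cosh w.2.2) * w.1)))
      ((volume.restrict (Ioi (0:ℝ))).prod ((volume.restrict (Ioi (0:ℝ))).prod volume)) := by
  have hre : (2 * ν - μ).re = 2 * ν.re - μ.re := by simp
  have hb1 : |1 - μ.re| < 1 := by rw [abs_lt]; constructor <;> linarith
  have hb2 : |1 - μ.re| < (2 * ν - μ).re + 1 := by rw [hre, abs_lt]; constructor <;> linarith
  obtain ⟨δ, hδ1, hδ2⟩ := exists_between (lt_min hb1 hb2)
  have hδ3 : δ < 1 := hδ2.trans_le (min_le_left _ _)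
  have hδ4 : δ < (2 * ν - μ).re + 1 := hδ2.trans_le (min_le_right _ _)
  have hδ0 : 0 ≤ δ := (abs_nonneg _).trans hδ1.le
  have i1 := gauss_int (κ := -δ) (by linarith) ‖z‖
  have i2 : IntegrableOn (fun ρ : ℝ => 2 * (ρ ^ ((2 * ν - μ).re - δ) * Real.exp (-1 * ρ^2))) (Ioi 0) :=
    (integrableOn_rpow_mul_exp_neg_mul_sq (b := 1) one_pos (by linarith)).const_mul 2
  have i3 := exp_abs_integrable (ε := δ - |1 - μ.re|) (by linarith)
  have i23 := Integrable.mul_prod i2 i3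
  have i123 := Integrable.mul_prod i1 i23
  have hW := WW_meas ν μ
  refine Integrable.mono' i123 (Measurable.aestronglyMeasurable (by fun_prop)) ?_
  have : (volume.restrict (Ioi (0:ℝ))).prod ((volume.restrict (Ioi (0:ℝ))).prod (volume : Measure ℝ))
    = (volume.prod (volume.prod volume)).restrict (Ioi (0:ℝ) ×ˢ (Ioi (0:ℝ) ×ˢ univ)) := by
    rw [← Measure.prod_restrict, ← Measure.prod_restrict, Measure.restrict_univ]
  rw [this]
  refine (ae_restrict_iff' (measurableSet_Ioi.prod (measurableSet_Ioi.prod MeasurableSet.univ))).2 (Filter.Eventually.of_forall ?_)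
  rintro ⟨x, ρ, η⟩ ⟨hx, hρ, -⟩
  simp only [mem_Ioi] at hx hρ
  simp only
  have hy : 0 < ρ * Real.exp |η| * x := by positivity
  have h1 : ‖Complex.exp (-(2 * ρ * Complex.cosh η) * x)‖ ≤ ρ ^ (-δ) * Real.exp (-δ * |η|) * x ^ (-δ) := by
    have e : -(2 * (ρ:ℂ) * Complex.cosh η) * x = ((-(2 * ρ * Real.cosh η * x) : ℝ) : ℂ) := by push_cast; ring
    rw [e, Complex.norm_exp, ofReal_re]
    have hc : Real.exp |η| ≤ 2 * Real.cosh η := by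
      rw [← Real.cosh_abs, Real.cosh_eq]
      have := Real.exp_pos (-|η|)
      linarith
    calc Real.exp (-(2 * ρ * Real.cosh η * x)) ≤ Real.exp (-(ρ * Real.exp |η| * x)) := by
          apply Real.exp_le_exp.2
          apply neg_le_neg
          have : 2 * ρ * Real.cosh η * x = ρ * (2 * Real.cosh η) * x := by ring
          rw [this]; gcongr
      _ ≤ (ρ * Real.exp |η| * x) ^ (-δ) := rpow_mul_exp_neg_le hy hδ0 hδ3.le
      _ = _ := by
        rw [Real.mul_rpow (by positivity) hx.le, Real.mul_rpow hρ.le (by positivity), ← Real.exp_mul]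
        ring_nf
  have h2 := norm_q z hx.le
  have h3 : Real.exp (η * (1 - μ.re)) ≤ Real.exp (|1 - μ.re| * |η|) := by
    apply Real.exp_le_exp.2
    rw [mul_comm, ← abs_mul]; exact le_abs_self _
  rw [norm_mul, norm_mul (WW ν μ (ρ, η)), WW_norm ν μ (p := (ρ, η)) hρ]
  simp only
  calc _ ≤ Real.exp (‖z‖ * x - x^2/2) * (2 * (ρ ^ (2 * ν - μ).re * Real.exp (-ρ^2)) * Real.exp (|1 - μ.re| * |η|) * (ρ ^ (-δ) * Real.exp (-δ * |η|) * x ^ (-δ))) := by gcongr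
    _ = _ := by
      have a1 : -(δ - |1 - μ.re|) * |η| = |1 - μ.re| * |η| + -δ * |η| := by ring
      rw [a1, Real.exp_add, sub_eq_add_neg (2 * ν - μ).re δ, Real.rpow_add hρ]
      ring_nf

theorem rhs_eq (ν μ z : ℂ) (hν : 0 < ν.re) (hμ0 : 0 < μ.re) (hμ2 : μ.re < 2)
    (hμν : μ.re < ν.re + 1) :
    Complex.Gamma (ν + 1 - μ) * (∫ x in Ioi (0:ℝ), Complex.sin (z * x) *
        (x:ℂ) ^ (μ - 1) * Complex.exp (-(x:ℂ)^2 / 2) *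
        ((1 / Complex.Gamma ν) *
          ∫ u in Ioi (0:ℝ), Complex.exp (-(x:ℂ)^2 * u) * (u:ℂ) ^ (ν - 1) *
            ((1:ℂ) + (u:ℂ)) ^ (μ - ν - 1))) =
    1 / Complex.Gamma ν * ∫ ρ in Ioi (0:ℝ), (2 * ((ρ : ℂ) ^ (2 * ν - μ) * Complex.exp (-(ρ:ℂ)^2))) *
      ∫ η : ℝ, Complex.exp (η * (1 - μ)) * hh z (2 * ρ * Complex.cosh η) := by
  have T := triple_integrable ν μ z hν hμ0 hμ2 hμν
  have s := integral_integral_swap (f := fun (x : ℝ) (p : ℝ × ℝ) => Complex.sin (z * x) * Complex.exp (-(x:ℂ)^2 / 2) *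
        (WW ν μ p * Complex.exp (-(2 * p.1 * Complex.cosh p.2) * x))) T
  have e1 : Complex.Gamma (ν + 1 - μ) * (∫ x in Ioi (0:ℝ), Complex.sin (z * x) *
        (x:ℂ) ^ (μ - 1) * Complex.exp (-(x:ℂ)^2 / 2) *
        ((1 / Complex.Gamma ν) *
          ∫ u in Ioi (0:ℝ), Complex.exp (-(x:ℂ)^2 * u) * (u:ℂ) ^ (ν - 1) *
            ((1:ℂ) + (u:ℂ)) ^ (μ - ν - 1))) = 1 / Complex.Gamma ν * ∫ x in Ioi (0:ℝ), ∫ p : ℝ × ℝ, Complex.sin (z * x) * Complex.exp (-(x:ℂ)^2 / 2) *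
        (WW ν μ p * Complex.exp (-(2 * p.1 * Complex.cosh p.2) * x)) ∂((volume.restrict (Ioi (0:ℝ))).prod volume) := by
    rw [← integral_const_mul, ← integral_const_mul]
    refine setIntegral_congr_fun measurableSet_Ioi fun x hx => ?_
    rw [integral_const_mul, ← psi_double ν μ hν hμν hx]
    ring
  have e2 : ∀ p : ℝ × ℝ, ∫ x in Ioi (0:ℝ), Complex.sin (z * x) * Complex.exp (-(x:ℂ)^2 / 2) *
        (WW ν μ p * Complex.exp (-(2 * p.1 * Complex.cosh p.2) * x)) = WW ν μ p * hh z (2 * p.1 * Complex.cosh p.2) := by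
    intro p
    rw [hh, ← integral_const_mul]
    congr 1; ext x; ring
  have T2 := T.integral_prod_right
  simp only [e2] at s T2
  rw [e1, s, integral_prod _ T2]
  congr 1
  refine setIntegral_congr_fun measurableSet_Ioi fun ρ hρ => ?_
  simp only
  rw [← integral_const_mul]
  congr 1; ext η
  simp only [WW]; ring

theorem gfun_integrable (z w : ℂ) (hw : -1 < w.re) :
    IntegrableOn (fun t : ℝ => Complex.exp (z * t - (t:ℂ)^2 / 2) * (t:ℂ) ^ w) (Ioi 0) := by
  refine Integrable.mono' (gauss_int hw z.re) (Measurable.aestronglyMeasurable (by fun_prop)) ?_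
  refine (ae_restrict_iff' measurableSet_Ioi).2 (Filter.Eventually.of_forall fun t ht => ?_)
  rw [norm_mul, norm_cpw ht, Complex.norm_exp, mul_comm]
  have : (z * t - (t:ℂ)^2/2).re = z.re * t - t^2/2 := by
    have : ((t:ℂ)^2/2) = ((t^2/2 : ℝ) : ℂ) := by push_cast; ring
    rw [this, sub_re, ofReal_re]; simp
  rw [this]

theorem lhs_eq (ν μ z : ℂ) (hν : 0 < ν.re) (hμν : μ.re < ν.re + 1) :
      ((∫ t in Ioi (0:ℝ), Complex.exp (-z * t - (t:ℂ)^2 / 2) * (t:ℂ) ^ (ν - 1)) *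
        (∫ s in Ioi (0:ℝ), Complex.exp (z * s - (s:ℂ)^2 / 2) * (s:ℂ) ^ (ν - μ)) -
       (∫ t in Ioi (0:ℝ), Complex.exp (z * t - (t:ℂ)^2 / 2) * (t:ℂ) ^ (ν - 1)) *
        (∫ s in Ioi (0:ℝ), Complex.exp (-z * s - (s:ℂ)^2 / 2) * (s:ℂ) ^ (ν - μ))) =
    ∫ ρ in Ioi (0:ℝ), (2 * ((ρ : ℂ) ^ (2 * ν - μ) * Complex.exp (-(ρ:ℂ)^2))) *
      ∫ x : ℝ, Complex.exp (x * (1 - μ)) *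
      ((Complex.exp (z * (2 * ρ * Real.sinh x : ℝ)) - Complex.exp (-z * (2 * ρ * Real.sinh x : ℝ)))
        * Complex.exp (-((2 * ρ * Real.sinh x : ℝ):ℂ)^2/2)) := by
  have hA : ∀ z : ℂ, _ := fun z => gfun_integrable z (ν - 1) (by simp; linarith)
  have hB : ∀ z : ℂ, _ := fun z => gfun_integrable z (ν - μ) (by simp; linarith)
  have p1 := Integrable.mul_prod (hA (-z)) (hB z)
  have p2 := Integrable.mul_prod (hA z) (hB (-z))
  rw [← integral_prod_mul, ← integral_prod_mul, ← integral_sub p1 p2, covP_integral]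
  have c := covP_integrable _ (p1.sub p2)
  simp only [Pi.sub_apply] at c
  rw [integral_prod _ c]
  refine setIntegral_congr_fun measurableSet_Ioi fun ρ hρ => ?_
  simp only
  rw [← integral_const_mul]
  congr 1; ext η
  have hρ : 0 < ρ := hρ
  have w := weight_eq ν μ (p := (ρ, η)) hρ
  simp only at w
  have ex : ∀ z : ℂ, Complex.exp (-z * ((covM (ρ, η)).1 : ℝ) - (((covM (ρ, η)).1 : ℝ) : ℂ)^2/2) * Complex.exp (z * ((covM (ρ, η)).2 : ℝ) - (((covM (ρ, η)).2 : ℝ) : ℂ)^2/2)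
     = Complex.exp (-(ρ:ℂ)^2) * (Complex.exp (z * (2 * ρ * Real.sinh η : ℝ)) * Complex.exp (-((2 * ρ * Real.sinh η : ℝ):ℂ)^2/2)) := by
    intro z
    rw [← Complex.exp_add, ← Complex.exp_add, ← Complex.exp_add]
    congr 1
    simp only [covM, Real.sinh_eq]
    push_cast
    have : Complex.exp (-(η:ℂ)) * Complex.exp η = 1 := by rw [← Complex.exp_add]; simp
    linear_combination (-(ρ:ℂ)^2) * this
  have x1 := ex z
  have x2 := ex (-z)
  rw [neg_neg] at x2
  generalize Complex.exp (-z * ((covM (ρ, η)).1 : ℝ) - (((covM (ρ, η)).1 : ℝ) : ℂ)^2/2) = A1 at *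
  generalize Complex.exp (z * ((covM (ρ, η)).2 : ℝ) - (((covM (ρ, η)).2 : ℝ) : ℂ)^2/2) = A2 at *
  generalize Complex.exp (z * ((covM (ρ, η)).1 : ℝ) - (((covM (ρ, η)).1 : ℝ) : ℂ)^2/2) = A3 at *
  generalize Complex.exp (-z * ((covM (ρ, η)).2 : ℝ) - (((covM (ρ, η)).2 : ℝ) : ℂ)^2/2) = A4 at *
  generalize ((((covM (ρ, η)).1 : ℝ) : ℂ) ^ (ν - 1)) = B1 at *
  generalize ((((covM (ρ, η)).2 : ℝ) : ℂ) ^ (ν - μ)) = B2 at *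
  calc _ = (2 * ρ * (B1 * B2)) * (A1 * A2 - A3 * A4) := by ring
    _ = _ := by rw [w, x1, x2]; ring

theorem product_parabolic_cylinder_fourier_sine
    (ν μ z : ℂ) (hν : 0 < ν.re) (hμ0 : 0 < μ.re) (hμ2 : μ.re < 2)
    (hμν : μ.re < ν.re + 1) :
    (Complex.exp (-z^2 / 2) / (Complex.Gamma ν * Complex.Gamma (ν + 1 - μ))) *
      ((∫ t in Ioi (0:ℝ), Complex.exp (-z * t - (t:ℂ)^2 / 2) * (t:ℂ) ^ (ν - 1)) *
        (∫ s in Ioi (0:ℝ), Complex.exp (z * s - (s:ℂ)^2 / 2) * (s:ℂ) ^ (ν - μ)) -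
       (∫ t in Ioi (0:ℝ), Complex.exp (z * t - (t:ℂ)^2 / 2) * (t:ℂ) ^ (ν - 1)) *
        (∫ s in Ioi (0:ℝ), Complex.exp (-z * s - (s:ℂ)^2 / 2) * (s:ℂ) ^ (ν - μ))) =
    ((4 / Real.sqrt (2 * Real.pi) : ℝ) : ℂ) * Complex.cos ((Real.pi : ℂ) * μ / 2) *
      ∫ x in Ioi (0:ℝ), Complex.sin (z * x) *
        (x:ℂ) ^ (μ - 1) * Complex.exp (-(x:ℂ)^2 / 2) *
        ((1 / Complex.Gamma ν) *
          ∫ u in Ioi (0:ℝ), Complex.exp (-(x:ℂ)^2 * u) * (u:ℂ) ^ (ν - 1) *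
            ((1:ℂ) + (u:ℂ)) ^ (μ - ν - 1)) := by
  have R := rhs_eq ν μ z hν hμ0 hμ2 hμν
  have L := lhs_eq ν μ z hν hμν
  have hG1 : Complex.Gamma ν ≠ 0 := Complex.Gamma_ne_zero_of_re_pos hν
  have hG2 : Complex.Gamma (ν + 1 - μ) ≠ 0 := Complex.Gamma_ne_zero_of_re_pos (by simp; linarith)
  have hs : ((Real.sqrt (2 * Real.pi) : ℝ) : ℂ) ≠ 0 := by
    have : 0 < Real.sqrt (2 * Real.pi) := Real.sqrt_pos.2 (by positivity)
    exact_mod_cast this.ne'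
  have J : Complex.cos ((Real.pi : ℂ) * μ / 2) * (∫ ρ in Ioi (0:ℝ), (2 * ((ρ : ℂ) ^ (2 * ν - μ) * Complex.exp (-(ρ:ℂ)^2))) *
      ∫ η : ℝ, Complex.exp (η * (1 - μ)) * hh z (2 * ρ * Complex.cosh η)) =
      ((Real.sqrt (2 * Real.pi) : ℝ) / 4 * Complex.exp (-z^2/2)) * ∫ ρ in Ioi (0:ℝ), (2 * ((ρ : ℂ) ^ (2 * ν - μ) * Complex.exp (-(ρ:ℂ)^2))) *
      ∫ x : ℝ, Complex.exp (x * (1 - μ)) *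
      ((Complex.exp (z * (2 * ρ * Real.sinh x : ℝ)) - Complex.exp (-z * (2 * ρ * Real.sinh x : ℝ)))
        * Complex.exp (-((2 * ρ * Real.sinh x : ℝ):ℂ)^2/2)) := by
    rw [← integral_const_mul, ← integral_const_mul]
    refine setIntegral_congr_fun measurableSet_Ioi fun ρ hρ => ?_
    have := inner_id z μ hμ0 hμ2 hρ
    rw [mul_left_comm, this]
    ring
  rw [← L] at J
  have R' := eq_div_of_mul_eq hG2 ((mul_comm _ _).trans R)
  rw [R']
  push_cast
  set Q := ∫ ρ in Ioi (0:ℝ), (2 * ((ρ : ℂ) ^ (2 * ν - μ) * Complex.exp (-(ρ:ℂ)^2))) *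
      ∫ η : ℝ, Complex.exp (η * (1 - μ)) * hh z (2 * ρ * Complex.cosh η)
  have : (4 / ((Real.sqrt (2 * Real.pi) : ℝ) : ℂ)) * Complex.cos ((Real.pi : ℂ) * μ / 2) * (1 / Complex.Gamma ν * Q / Complex.Gamma (ν + 1 - μ))
    = (4 / ((Real.sqrt (2 * Real.pi) : ℝ) : ℂ)) * (Complex.cos ((Real.pi : ℂ) * μ / 2) * Q) / (Complex.Gamma ν * Complex.Gamma (ν + 1 - μ)) := by
    field_simp
  rw [this, J]
  field_simp
end

section
/- Let ν, z ∈ ℂ with Re ν > 0. Then e^(−z²) · (∫₀^∞ e^(−z·t − t²/2) t^(ν−1) dt) · (∫₀^∞ e^(z·t − t²/2) t^(ν−1) dt) = (2·Γ(ν)/√π) · ∫₀^∞ ∫₀^1 cos(2·z·x) · e^(−2x² + x²·u) · u^(−1/2) · (1−u)^(ν−1) du dx. (This is eq. (36) of Theorem 3: e^(−z²/2)·D₋ν(z)·D₋ν(−z) = (2/Γ(ν+1/2)) ∫₀^∞ cos(2zx) e^(−2x²) Φ(1/2, ν+1/2; x²) dx, written with Φ replaced by its Euler integral and each D by its Laplace-integral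 representation.) -/
open MeasureTheory Complex Set

lemma aux_half_cpow (r : ℝ) (hr : 0 ≤ r) : (r : ℂ) ^ (1 / 2 : ℂ) = ((Real.sqrt r : ℝ) : ℂ) := by
  rw [Real.sqrt_eq_rpow, Complex.ofReal_cpow hr]
  norm_num

lemma aux_gauss (b : ℝ) (hb : 0 < b) (c : ℂ) :
    ∫ x : ℝ, cexp (-b * (x:ℂ) ^ 2 + c * x) =
      ((Real.sqrt (Real.pi / b) : ℝ) : ℂ) * cexp (c ^ 2 / (4 * b)) := by
  have h := integral_cexp_quadratic (b := -(b:ℂ)) (by simpa using hb) c 0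
  simp only [add_zero] at h
  rw [h, ← aux_half_cpow _ (by positivity)]
  push_cast
  congr 2
  · simp
  · rw [zero_sub]
    field_simp

lemma aux_gauss_int (b : ℝ) (hb : 0 < b) (c : ℂ) :
    Integrable (fun x : ℝ => cexp (-b * (x:ℂ) ^ 2 + c * x)) := by
  simpa using integrable_cexp_quadratic (b := (b:ℂ)) (by simpa using hb) c 0

lemma aux_half (b : ℝ) (hb : 0 < b) (z : ℂ) :
    ∫ x in Ioi (0:ℝ), Complex.cos (2 * z * x) * cexp (-b * (x:ℂ) ^ 2) =
      ((Real.sqrt (Real.pi / b) : ℝ) : ℂ) / 2 * cexp (-z ^ 2 / b) := by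
  have hi := aux_gauss_int b hb (2 * z * I)
  have hg := aux_gauss b hb (2 * z * I)
  set h : ℝ → ℂ := fun x : ℝ => cexp (-b * (x:ℂ) ^ 2 + (2 * z * I) * x) with hh
  have h1 : ∀ x : ℝ, Complex.cos (2 * z * x) * cexp (-b * (x:ℂ) ^ 2) = (h x + h (-x)) / 2 := by
    intro x
    simp only [hh, Complex.cos, Complex.exp_add, add_div, ofReal_neg, neg_sq, add_mul]
    rw [show 2 * z * (x:ℂ) * I = 2 * z * I * x by ring,
      show -(2 * z * (x:ℂ)) * I = 2 * z * I * -(x:ℂ) by ring]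
    ring
  simp_rw [h1]
  rw [integral_div, integral_add hi.integrableOn hi.comp_neg.integrableOn,
    integral_comp_neg_Ioi (c := (0:ℝ)) h, neg_zero, add_comm,
    ← setIntegral_union (Iic_disjoint_Ioi le_rfl) measurableSet_Ioi hi.integrableOn hi.integrableOn,
    Iic_union_Ioi, setIntegral_univ, hg]
  have : (2 * z * I) ^ 2 / (4 * (b:ℂ)) = -z ^ 2 / b := by
    rw [mul_pow, I_sq]; field_simp; ring
  rw [this]; ring

lemma aux_int (ν c : ℂ) (hν : 0 < ν.re) :
    IntegrableOn (fun t : ℝ => cexp (c * t - (t:ℂ) ^ 2 / 2) * (t:ℂ) ^ (ν - 1)) (Ioi 0) := by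
  have h := Complex.GammaIntegral_convergent hν
  have h2 := h.bdd_mul (f := fun t : ℝ => cexp ((c + 1) * t - (t:ℂ) ^ 2 / 2))
    (c := Real.exp ((c.re + 1) ^ 2 / 2))
    (Continuous.aestronglyMeasurable (by fun_prop)) (Filter.Eventually.of_forall fun t => by
      rw [Complex.norm_exp]
      apply Real.exp_le_exp.2
      have : ((c + 1) * t - (t:ℂ) ^ 2 / 2).re = (c.re + 1) * t - t ^ 2 / 2 := by
        rw [show (t:ℂ) ^ 2 / 2 = ((t ^ 2 / 2 : ℝ) : ℂ) by push_cast; ring]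
        simp [-ofReal_div, -ofReal_pow]
      rw [this]
      nlinarith [sq_nonneg (c.re + 1 - t)])
  refine h2.congr (Filter.Eventually.of_forall fun t => ?_)
  simp only [ofReal_exp, ← mul_assoc, ← Complex.exp_add]
  congr 2
  push_cast
  ring

lemma aux_prod (F G : ℝ → ℂ) (hF : IntegrableOn F (Ioi 0)) (hG : IntegrableOn G (Ioi 0)) :
    (∫ t in Ioi (0:ℝ), F t) * (∫ t in Ioi (0:ℝ), G t) =
      ∫ d : ℝ, ∫ s in Ioi (max 0 d), F s * G (s - d) := by
  have hF' := (integrable_indicator_iff (measurableSet_Ioi (a := (0:ℝ)))).2 hF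
  have hG' := (integrable_indicator_iff (measurableSet_Ioi (a := (0:ℝ)))).2 hG
  have h := integral_convolution (ContinuousLinearMap.mul ℝ ℂ) hF' hG'.comp_neg
    (μ := volume) (ν := volume)
  simp only [ContinuousLinearMap.mul_apply', convolution_def] at h
  rw [integral_neg_eq_self, integral_indicator measurableSet_Ioi,
    integral_indicator measurableSet_Ioi] at h
  rw [← h]
  congr 1
  ext d
  rw [← integral_indicator measurableSet_Ioi]
  congr 1
  ext s
  rw [neg_sub]
  by_cases h1 : 0 < s <;> by_cases h2 : d < s <;>
    simp [indicator, h1, h2]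

lemma aux_sub (d : ℝ) (G : ℝ → ℂ) :
    ∫ s in Ioi (max 0 d), G (s * (s - d)) =
      ∫ q in Ioi (0:ℝ), (((Real.sqrt (d ^ 2 + 4 * q))⁻¹ : ℝ) : ℂ) * G q := by
  have him : (fun s => s * (s - d)) '' Ioi (max 0 d) = Ioi 0 := by
    ext q
    simp only [mem_image, mem_Ioi, max_lt_iff]
    constructor
    · rintro ⟨s, ⟨h1, h2⟩, rfl⟩
      exact mul_pos h1 (by linarith)
    · intro hq
      have hs : 0 ≤ d ^ 2 + 4 * q := by positivity
      have hlt : |d| < Real.sqrt (d ^ 2 + 4 * q) := by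
        rw [← Real.sqrt_sq_eq_abs]
        exact Real.sqrt_lt_sqrt (by positivity) (by linarith)
      have := abs_lt.1 hlt
      refine ⟨(d + Real.sqrt (d ^ 2 + 4 * q)) / 2, ⟨by linarith, by linarith⟩, ?_⟩
      nlinarith [Real.sq_sqrt hs]
  rw [← him, integral_image_eq_integral_abs_deriv_smul measurableSet_Ioi
    (f' := fun s => 2 * s - d)]
  · refine setIntegral_congr_fun measurableSet_Ioi fun s hs => ?_
    obtain ⟨h1, h2⟩ := max_lt_iff.1 (mem_Ioi.1 hs)
    have h3 : 0 < 2 * s - d := by linarith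
    rw [show d ^ 2 + 4 * (s * (s - d)) = (2 * s - d) ^ 2 by ring, Real.sqrt_sq h3.le,
      abs_of_pos h3, real_smul, ← mul_assoc, ← ofReal_mul, mul_inv_cancel₀ h3.ne']
    simp
  · intro x _
    have := ((hasDerivAt_id x).mul ((hasDerivAt_id x).sub_const d)).hasDerivWithinAt (s := Ioi (max 0 d))
    convert! this using 1
    simp; ring
  · intro x hx y hy hxy
    obtain ⟨h1, h2⟩ := max_lt_iff.1 (mem_Ioi.1 hx)
    obtain ⟨h3, h4⟩ := max_lt_iff.1 (mem_Ioi.1 hy)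
    simp only at hxy
    have : (x - y) * (x + y - d) = 0 := by linarith
    rcases mul_eq_zero.1 this with h | h
    · linarith
    · linarith

lemma aux_gauss_norm (b : ℝ) (hb : 0 < b) (c : ℂ) :
    ∫ x : ℝ, ‖cexp (-b * (x:ℂ) ^ 2 + c * x)‖ =
      Real.sqrt (Real.pi / b) * Real.exp (c.re ^ 2 / (4 * b)) := by
  have h := aux_gauss b hb (c.re : ℂ)
  rw [← Complex.ofReal_inj, ← integral_complex_ofReal]
  push_cast
  rw [← h]
  congr 1
  ext x
  rw [Complex.norm_exp]
  push_cast
  congr 1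
  rw [show -(b:ℂ) * (x:ℂ) ^ 2 + c * x = ((-b * x ^ 2 : ℝ) : ℂ) + c * x by push_cast; ring]
  simp [-ofReal_mul, -ofReal_neg, -ofReal_pow]
  push_cast
  ring

lemma aux_S1 (ν : ℂ) (hν : 0 < ν.re) (d : ℝ) (hd : d ≠ 0) :
    ∫ q in Ioi (0:ℝ), (((Real.sqrt (d ^ 2 + 4 * q))⁻¹ : ℝ) : ℂ) *
        (((Real.exp (-q) : ℝ) : ℂ) * (q:ℂ) ^ (ν - 1)) =
      (2 / ((Real.sqrt Real.pi : ℝ) : ℂ)) * ∫ y in Ioi (0:ℝ),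
        ((Real.exp (-(y ^ 2 * d ^ 2)) : ℝ) : ℂ) *
          ((1 / ((1 + 4 * y ^ 2 : ℝ) : ℂ)) ^ ν * Gamma ν) := by
  have hd2 : 0 < d ^ 2 := by positivity
  set f : ℝ → ℝ → ℂ := fun q y => ((Real.exp (-q) : ℝ) : ℂ) * (q:ℂ) ^ (ν - 1) *
    ((Real.exp (-(d ^ 2 + 4 * q) * y ^ 2) : ℝ) : ℂ) with hf
  have hG := Complex.GammaIntegral_convergent hν
  have hgi : ∀ q : ℝ, ∫ y in Ioi (0:ℝ), Real.exp (-(d ^ 2 + 4 * q) * y ^ 2) =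
    Real.sqrt (Real.pi / (d ^ 2 + 4 * q)) / 2 := fun q => integral_gaussian_Ioi _
  have hint : Integrable (Function.uncurry f)
      ((volume.restrict (Ioi (0:ℝ))).prod (volume.restrict (Ioi (0:ℝ)))) := by
    rw [integrable_prod_iff]
    · constructor
      · filter_upwards [ae_restrict_mem measurableSet_Ioi] with q hq
        have hq : 0 < q := hq
        have : IntegrableOn (fun y : ℝ => Real.exp (-(d ^ 2 + 4 * q) * y ^ 2)) (Ioi 0) :=
          (integrable_exp_neg_mul_sq (by positivity)).integrableOn
        simp only [Function.uncurry, hf]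
        exact (this.ofReal (𝕜 := ℂ)).const_mul _
      · have h1 : ∀ q : ℝ, ∫ y in Ioi (0:ℝ), ‖Function.uncurry f (q, y)‖ =
            (Real.sqrt (Real.pi / (d ^ 2 + 4 * q)) / 2) *
              ‖((Real.exp (-q) : ℝ) : ℂ) * (q:ℂ) ^ (ν - 1)‖ := by
          intro q
          simp only [Function.uncurry, hf, norm_mul]
          rw [integral_const_mul, ← hgi q, mul_comm]
          simp only [norm_real, Real.norm_eq_abs, Real.abs_exp]
        simp_rw [h1]
        refine hG.norm.bdd_mul (c := Real.sqrt (Real.pi / d ^ 2) / 2) ?_ ?_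
        · exact Measurable.aestronglyMeasurable (by fun_prop)
        · filter_upwards [ae_restrict_mem measurableSet_Ioi] with q hq
          have hq : 0 < q := hq
          rw [Real.norm_of_nonneg (by positivity)]
          gcongr
          linarith
    · refine Measurable.aestronglyMeasurable ?_
      simp only [Function.uncurry_def, hf]
      fun_prop
  have hswap := integral_integral_swap hint
  have e1 : ∀ y : ℝ, ∫ q in Ioi (0:ℝ), f q y = ((Real.exp (-(y ^ 2 * d ^ 2)) : ℝ) : ℂ) *
          ((1 / ((1 + 4 * y ^ 2 : ℝ) : ℂ)) ^ ν * Gamma ν) := by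
    intro y
    rw [← integral_cpow_mul_exp_neg_mul_Ioi hν (by positivity : 0 < 1 + 4 * y ^ 2),
      ← integral_const_mul]
    congr 1
    ext q
    simp only [hf]
    push_cast
    rw [mul_comm (cexp _) ((q:ℂ) ^ _), mul_assoc, mul_left_comm (cexp _) ((q:ℂ) ^ _),
      ← Complex.exp_add, ← Complex.exp_add]
    congr 2
    ring
  have e2 : ∀ q ∈ Ioi (0:ℝ), (((Real.sqrt (d ^ 2 + 4 * q))⁻¹ : ℝ) : ℂ) *
        (((Real.exp (-q) : ℝ) : ℂ) * (q:ℂ) ^ (ν - 1)) =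
      (2 / ((Real.sqrt Real.pi : ℝ) : ℂ)) * ∫ y in Ioi (0:ℝ), f q y := by
    intro q hq
    have hq : 0 < q := hq
    simp only [hf]
    rw [integral_const_mul]
    rw [integral_complex_ofReal, hgi q, Real.sqrt_div Real.pi_pos.le]
    have h1 : Real.sqrt Real.pi ≠ 0 := (Real.sqrt_pos.2 Real.pi_pos).ne'
    have h1' : ((Real.sqrt Real.pi : ℝ) : ℂ) ≠ 0 := by exact_mod_cast h1
    have h2 : Real.sqrt (d ^ 2 + 4 * q) ≠ 0 := (Real.sqrt_pos.2 (by positivity)).ne'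
    have h2' : ((Real.sqrt (d ^ 2 + 4 * q) : ℝ) : ℂ) ≠ 0 := by exact_mod_cast h2
    simp only [coe_algebraMap, ofReal_div, ofReal_inv, ofReal_ofNat]
    field_simp
  rw [setIntegral_congr_fun measurableSet_Ioi e2, integral_const_mul, hswap]
  simp_rw [e1]

lemma aux_normK (ν : ℂ) (y : ℝ) :
    ‖(1 / ((1 + 4 * y ^ 2 : ℝ) : ℂ)) ^ ν‖ = (1 + 4 * y ^ 2) ^ (-ν.re) := by
  have h : 0 < 1 + 4 * y ^ 2 := by positivity
  rw [show (1 / ((1 + 4 * y ^ 2 : ℝ) : ℂ)) = ((1 / (1 + 4 * y ^ 2) : ℝ) : ℂ) by push_cast; rfl,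
    Complex.norm_cpow_eq_rpow_re_of_pos (by positivity), one_div, Real.inv_rpow h.le,
    Real.rpow_neg h.le]

lemma aux_S2 (ν z : ℂ) (hν : 0 < ν.re) :
    ∫ d : ℝ, ∫ y in Ioi (0:ℝ), (1 / ((1 + 4 * y ^ 2 : ℝ) : ℂ)) ^ ν *
        cexp (-((1 / 2 + y ^ 2 : ℝ) : ℂ) * (d:ℂ) ^ 2 + (-z) * d) =
      ∫ y in Ioi (0:ℝ), (1 / ((1 + 4 * y ^ 2 : ℝ) : ℂ)) ^ ν *
        (((Real.sqrt (Real.pi / (1 / 2 + y ^ 2)) : ℝ) : ℂ) *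
          cexp (z ^ 2 / (4 * ((1 / 2 + y ^ 2 : ℝ) : ℂ)))) := by
  have hb : ∀ y : ℝ, 0 < 1 / 2 + y ^ 2 := fun y => by positivity
  set f : ℝ → ℝ → ℂ := fun d y => (1 / ((1 + 4 * y ^ 2 : ℝ) : ℂ)) ^ ν *
        cexp (-((1 / 2 + y ^ 2 : ℝ) : ℂ) * (d:ℂ) ^ 2 + (-z) * d) with hf
  have hint : Integrable (Function.uncurry f)
      ((volume : Measure ℝ).prod (volume.restrict (Ioi (0:ℝ)))) := by
    rw [integrable_prod_iff']
    · constructor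
      · refine Filter.Eventually.of_forall fun y => ?_
        simp only [Function.uncurry, hf]
        exact (aux_gauss_int _ (hb y) (-z)).const_mul _
      · have h1 : ∀ y : ℝ, ∫ d : ℝ, ‖Function.uncurry f (d, y)‖ =
            (1 + 4 * y ^ 2) ^ (-ν.re) * (Real.sqrt (Real.pi / (1 / 2 + y ^ 2)) *
              Real.exp (z.re ^ 2 / (4 * (1 / 2 + y ^ 2)))) := by
          intro y
          simp only [Function.uncurry, hf, norm_mul]
          rw [integral_const_mul, aux_normK, aux_gauss_norm _ (hb y)]
          simp
        simp_rw [h1]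
        have hJ := integrable_rpow_neg_one_add_norm_sq (E := ℝ) (μ := volume) (r := 1 + 2 * ν.re)
          (by simp [hν])
        refine Integrable.mono' ((hJ.const_mul (Real.sqrt (2 * Real.pi) *
          Real.exp (z.re ^ 2 / 2))).integrableOn) ?_ ?_
        · exact Measurable.aestronglyMeasurable (by fun_prop)
        · refine Filter.Eventually.of_forall fun y => ?_
          have h0 : 0 < 1 + y ^ 2 := by positivity
          rw [Real.norm_of_nonneg (by positivity), Real.norm_eq_abs, sq_abs]
          have a1 : (1 + 4 * y ^ 2) ^ (-ν.re) ≤ (1 + y ^ 2) ^ (-ν.re) :=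
            Real.rpow_le_rpow_of_nonpos h0 (by nlinarith) (by linarith)
          have a2 : Real.sqrt (Real.pi / (1 / 2 + y ^ 2)) ≤
              Real.sqrt (2 * Real.pi) * (1 + y ^ 2) ^ (-(1/2) : ℝ) := by
            rw [Real.rpow_neg h0.le, ← Real.sqrt_eq_rpow, ← Real.sqrt_inv, ← Real.sqrt_mul (by positivity)]
            apply Real.sqrt_le_sqrt
            rw [← div_eq_mul_inv, div_le_div_iff₀ (hb y) h0]
            nlinarith [Real.pi_pos, mul_nonneg Real.pi_pos.le (sq_nonneg y)]
          have a3 : Real.exp (z.re ^ 2 / (4 * (1 / 2 + y ^ 2))) ≤ Real.exp (z.re ^ 2 / 2) := by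
            apply Real.exp_le_exp.2
            gcongr
            nlinarith
          have a4 : (1 + y ^ 2) ^ (-(1 + 2 * ν.re) / 2) =
              (1 + y ^ 2) ^ (-ν.re) * (1 + y ^ 2) ^ (-(1/2) : ℝ) := by
            rw [← Real.rpow_add h0]; congr 1; ring
          rw [a4]
          calc _ ≤ (1 + y ^ 2) ^ (-ν.re) * ((Real.sqrt (2 * Real.pi) * (1 + y ^ 2) ^ (-(1/2) : ℝ)) *
                  Real.exp (z.re ^ 2 / 2)) := by gcongr
            _ = _ := by ring
    · refine Measurable.aestronglyMeasurable ?_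
      simp only [Function.uncurry_def, hf]
      fun_prop
  rw [integral_integral_swap hint]
  congr 1
  ext y
  simp only [hf]
  rw [integral_const_mul, aux_gauss _ (hb y)]
  simp

/-- common middle expression -/
lemma aux_left (ν z : ℂ) (hν : 0 < ν.re) :
    (∫ t in Ioi (0:ℝ), Complex.exp (-z * t - (t:ℂ)^2 / 2) * (t:ℂ) ^ (ν - 1)) *
      (∫ t in Ioi (0:ℝ), Complex.exp (z * t - (t:ℂ)^2 / 2) * (t:ℂ) ^ (ν - 1)) =
    (2 * Gamma ν / ((Real.sqrt Real.pi : ℝ) : ℂ)) *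
      ∫ y in Ioi (0:ℝ), (1 / ((1 + 4 * y ^ 2 : ℝ) : ℂ)) ^ ν *
        (((Real.sqrt (Real.pi / (1 / 2 + y ^ 2)) : ℝ) : ℂ) *
          cexp (z ^ 2 / (4 * ((1 / 2 + y ^ 2 : ℝ) : ℂ)))) := by
  rw [aux_prod _ _ (aux_int ν (-z) hν) (aux_int ν z hν), ← aux_S2 ν z hν, ← integral_const_mul]
  refine integral_congr_ae ?_
  filter_upwards [Measure.ae_ne volume (0:ℝ)] with d hd
  have e1 : ∀ s ∈ Ioi (max 0 d), cexp (-z * s - (s:ℂ)^2 / 2) * (s:ℂ) ^ (ν - 1) *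
      (cexp (z * ((s - d : ℝ) : ℂ) - ((s - d : ℝ) : ℂ)^2 / 2) * ((s - d : ℝ) : ℂ) ^ (ν - 1)) =
      (fun q : ℝ => cexp (-z * d - (d:ℂ)^2 / 2) * (((Real.exp (-q) : ℝ) : ℂ) * (q:ℂ) ^ (ν - 1)))
        (s * (s - d)) := by
    intro s hs
    obtain ⟨h1, h2⟩ := max_lt_iff.1 (mem_Ioi.1 hs)
    have h3 : 0 ≤ s - d := by linarith
    simp only
    rw [ofReal_mul, mul_cpow_ofReal_nonneg h1.le h3, mul_mul_mul_comm, ← mul_assoc (cexp _),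
      ofReal_exp, ← Complex.exp_add, ← Complex.exp_add]
    congr 2
    push_cast
    ring
  rw [setIntegral_congr_fun measurableSet_Ioi e1, aux_sub d (fun q : ℝ =>
    cexp (-z * d - (d:ℂ)^2 / 2) * (((Real.exp (-q) : ℝ) : ℂ) * (q:ℂ) ^ (ν - 1)))]
  simp_rw [mul_left_comm _ (cexp (-z * d - (d:ℂ)^2 / 2))]
  rw [integral_const_mul, aux_S1 ν hν d hd, ← mul_assoc, ← integral_const_mul,
    ← integral_const_mul]
  congr 1
  ext y
  rw [show -((1 / 2 + y ^ 2 : ℝ) : ℂ) * (d:ℂ) ^ 2 + (-z) * d =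
    (-z * d - (d:ℂ)^2 / 2) + ((-(y ^ 2 * d ^ 2) : ℝ) : ℂ) by push_cast; ring, Complex.exp_add,
    ofReal_exp]
  ring

lemma aux_usub (g : ℝ → ℂ) :
    ∫ u in Ioo (0:ℝ) 1, g u = ∫ y in Ioi (0:ℝ),
      ((8 * y / (1 + 4 * y ^ 2) ^ 2 : ℝ) : ℂ) * g (1 - 1 / (1 + 4 * y ^ 2)) := by
  have him : (fun y : ℝ => 1 - 1 / (1 + 4 * y ^ 2)) '' Ioi 0 = Ioo 0 1 := by
    ext u
    simp only [mem_image, mem_Ioi, mem_Ioo]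
    constructor
    · rintro ⟨y, hy, rfl⟩
      have h1 : 1 / (1 + 4 * y ^ 2) < 1 := by
        rw [div_lt_one (by positivity)]
        have : 0 < y ^ 2 := by positivity
        linarith
      have h2 : 0 < 1 / (1 + 4 * y ^ 2) := by positivity
      exact ⟨by linarith, by linarith⟩
    · rintro ⟨h0, h1⟩
      have h2 : 0 < 1 - u := by linarith
      refine ⟨Real.sqrt (u / (4 * (1 - u))), Real.sqrt_pos.2 (by positivity), ?_⟩
      rw [Real.sq_sqrt (by positivity)]
      field_simp
      ring
  rw [← him, integral_image_eq_integral_abs_deriv_smul measurableSet_Ioi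
    (f' := fun y => 8 * y / (1 + 4 * y ^ 2) ^ 2)]
  · refine setIntegral_congr_fun measurableSet_Ioi fun y hy => ?_
    have hy : 0 < y := hy
    rw [abs_of_pos (by positivity), real_smul]
  · intro y _
    have hne : (1 + 4 * y ^ 2) ≠ 0 := by positivity
    have h1 : HasDerivAt (fun y : ℝ => 1 + 4 * y ^ 2) (8 * y) y := by
      have := ((hasDerivAt_pow 2 y).const_mul 4).const_add 1
      convert! this using 1
      simp; ring
    have h2 := (h1.inv hne).const_sub 1
    simp only [one_div]
    convert! h2.hasDerivWithinAt using 1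
    ring
  · intro x hx y hy hxy
    have hx : 0 < x := hx
    have hy : 0 < y := hy
    have h1 : 1 + 4 * x ^ 2 ≠ 0 := by positivity
    have h2 : 1 + 4 * y ^ 2 ≠ 0 := by positivity
    simp only [one_div, sub_right_inj, inv_inj] at hxy
    have : x ^ 2 = y ^ 2 := by linarith
    exact (sq_eq_sq₀ hx.le hy.le).1 this

lemma aux_right (ν z : ℂ) (hν : 0 < ν.re) :
    ∫ x in Ioi (0:ℝ), ∫ u in Ioo (0:ℝ) 1,
        Complex.cos (2 * z * x) *
          Complex.exp (-2 * (x:ℂ)^2 + (x:ℂ)^2 * u) *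
          (u:ℂ) ^ (-(1:ℂ)/2) * ((1:ℂ) - (u:ℂ)) ^ (ν - 1) =
    ∫ u in Ioo (0:ℝ) 1, ((Real.sqrt (Real.pi / (2 - u)) : ℝ) : ℂ) / 2 *
      cexp (-z ^ 2 / ((2 - u : ℝ) : ℂ)) * ((u:ℂ) ^ (-(1:ℂ)/2) * ((1:ℂ) - (u:ℂ)) ^ (ν - 1)) := by
  have hbeta : IntegrableOn (fun u : ℝ => (u:ℂ) ^ (-(1:ℂ)/2) * ((1:ℂ) - (u:ℂ)) ^ (ν - 1))
      (Ioo 0 1) := by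
    have := Complex.betaIntegral_convergent (u := 1/2) (v := ν) (by norm_num) hν
    rw [intervalIntegrable_iff_integrableOn_Ioo_of_le zero_le_one] at this
    rw [show (1:ℂ) / 2 - 1 = -1 / 2 by norm_num] at this
    exact this
  set f : ℝ → ℝ → ℂ := fun x u => Complex.cos (2 * z * x) *
          Complex.exp (-2 * (x:ℂ)^2 + (x:ℂ)^2 * u) *
          (u:ℂ) ^ (-(1:ℂ)/2) * ((1:ℂ) - (u:ℂ)) ^ (ν - 1) with hf
  have hcos : ∀ w : ℂ, ‖Complex.cos w‖ ≤ Real.exp ‖w‖ := by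
    intro w
    rw [Complex.cos, norm_div]
    have h1 : ‖cexp (w * I)‖ ≤ Real.exp ‖w‖ := by
      refine (Complex.norm_exp_le_exp_norm _).trans ?_
      simp
    have h2 : ‖cexp (-w * I)‖ ≤ Real.exp ‖w‖ := by
      refine (Complex.norm_exp_le_exp_norm _).trans ?_
      simp
    have h3 := norm_add_le (cexp (w * I)) (cexp (-w * I))
    simp only [Complex.norm_ofNat]
    linarith
  have hint : Integrable (Function.uncurry f)
      ((volume.restrict (Ioi (0:ℝ))).prod (volume.restrict (Ioo (0:ℝ) 1))) := by
    have hg : IntegrableOn (fun x : ℝ => cexp (-(1:ℝ) * (x:ℂ) ^ 2 + ((2 * ‖z‖ : ℝ) : ℂ) * x)) (Ioi 0) :=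
      (aux_gauss_int 1 one_pos _).integrableOn
    refine (Integrable.mul_prod hg hbeta).mono ?_ ?_
    · refine Measurable.aestronglyMeasurable ?_
      simp only [Function.uncurry_def, hf]
      fun_prop
    · rw [Measure.prod_restrict]
      filter_upwards [ae_restrict_mem (measurableSet_Ioi.prod measurableSet_Ioo)] with p hp
      obtain ⟨x, u⟩ := p
      obtain ⟨hx, hu0, hu1⟩ := hp
      simp only [mem_Ioi] at hx hu0 hu1
      simp only [Function.uncurry, hf]
      rw [mul_assoc (_ * _), norm_mul, norm_mul (cexp (-(1:ℝ) * (x:ℂ) ^ 2 + _))]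
      refine mul_le_mul_of_nonneg_right ?_ (norm_nonneg _)
      rw [norm_mul]
      have h1 := hcos (2 * z * x)
      have h2 : ‖cexp (-2 * (x:ℂ)^2 + (x:ℂ)^2 * u)‖ ≤ Real.exp (-x ^ 2) := by
        rw [show -2 * (x:ℂ)^2 + (x:ℂ)^2 * u = ((-2 * x ^ 2 + x ^ 2 * u : ℝ) : ℂ) by push_cast; ring,
          ← ofReal_exp, norm_real, Real.norm_eq_abs, Real.abs_exp]
        apply Real.exp_le_exp.2
        nlinarith [sq_nonneg x]
      have h3 : ‖cexp (-(1:ℝ) * (x:ℂ) ^ 2 + ((2 * ‖z‖ : ℝ) : ℂ) * x)‖ =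
          Real.exp ‖2 * z * x‖ * Real.exp (-x ^ 2) := by
        rw [show -((1:ℝ):ℂ) * (x:ℂ) ^ 2 + ((2 * ‖z‖ : ℝ) : ℂ) * x =
          ((2 * ‖z‖ * x + -x ^ 2 : ℝ) : ℂ) by push_cast; ring,
          ← ofReal_exp, norm_real, Real.norm_eq_abs, Real.abs_exp, ← Real.exp_add]
        simp [abs_of_pos hx]
      rw [h3]
      exact mul_le_mul h1 h2 (norm_nonneg _) (Real.exp_pos _).le
  rw [integral_integral_swap hint]
  refine setIntegral_congr_fun measurableSet_Ioo fun u hu => ?_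
  have h2 : 0 < 2 - u := by linarith [hu.2]
  simp only [hf]
  rw [← aux_half (2 - u) h2 z, ← integral_mul_const]
  congr 1
  ext x
  rw [mul_assoc (_ * _)]
  congr 3
  push_cast
  ring

theorem product_parabolic_cylinder_phi_cos_integral
    (ν z : ℂ) (hν : 0 < ν.re) :
    Complex.exp (-z^2) *
      (∫ t in Ioi (0:ℝ), Complex.exp (-z * t - (t:ℂ)^2 / 2) * (t:ℂ) ^ (ν - 1)) *
      (∫ t in Ioi (0:ℝ), Complex.exp (z * t - (t:ℂ)^2 / 2) * (t:ℂ) ^ (ν - 1)) =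
    (2 * Complex.Gamma ν / ((Real.sqrt Real.pi : ℝ) : ℂ)) *
      ∫ x in Ioi (0:ℝ), ∫ u in Ioo (0:ℝ) 1,
        Complex.cos (2 * z * x) *
          Complex.exp (-2 * (x:ℂ)^2 + (x:ℂ)^2 * u) *
          (u:ℂ) ^ (-(1:ℂ)/2) * ((1:ℂ) - (u:ℂ)) ^ (ν - 1) := by
  rw [mul_assoc, aux_left ν z hν, aux_right ν z hν, aux_usub, mul_left_comm,
    ← integral_const_mul]
  congr 1
  refine setIntegral_congr_fun measurableSet_Ioi fun y hy => ?_
  have hy : 0 < y := hy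
  set w : ℝ := 1 + 4 * y ^ 2 with hw
  have hw0 : 0 < w := by positivity
  have hw1 : (w:ℂ) ≠ 0 := by exact_mod_cast hw0.ne'
  have e1 : (1:ℂ) - ((1 - 1 / w : ℝ) : ℂ) = 1 / (w:ℂ) := by push_cast; ring
  have e2 : ((1 - 1 / w : ℝ) : ℂ) ^ (-(1:ℂ)/2) = ((Real.sqrt w / (2 * y) : ℝ) : ℂ) := by
    have : 1 - 1 / w = (2 * y) ^ 2 / w := by rw [hw]; field_simp; ring
    rw [this, neg_div, cpow_neg, aux_half_cpow _ (by positivity), ← ofReal_inv,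
      Real.sqrt_div (by positivity), Real.sqrt_sq (by positivity), inv_div]
  have e3 : (2 - (1 - 1 / w)) = (w + 1) / w := by field_simp; ring
  have e4 : 1 / 2 + y ^ 2 = (w + 1) / 4 := by rw [hw]; ring
  have e5 : (1 / (w:ℂ)) ^ (ν - 1) = (1 / (w:ℂ)) ^ ν * w := by
    rw [cpow_sub _ _ (one_div_ne_zero hw1), cpow_one]; field_simp
  have e6 : Real.sqrt (Real.pi / ((w + 1) / w)) = Real.sqrt (Real.pi / ((w + 1) / 4)) * Real.sqrt w / 2 := by
    rw [← Real.sqrt_mul (by positivity), show (2:ℝ) = Real.sqrt (2 ^ 2) by rw [Real.sqrt_sq (by norm_num)],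
      ← Real.sqrt_div (by positivity)]
    congr 1
    norm_num
    field_simp
  have hs : ((Real.sqrt w : ℝ) : ℂ) ^ 2 = w := by
    rw [← ofReal_pow, Real.sq_sqrt hw0.le]
  have hw2 : (w:ℂ) + 1 ≠ 0 := by exact_mod_cast (by positivity : w + 1 ≠ 0)
  have e7 : cexp (-z ^ 2) * cexp (z ^ 2 / (4 * (((w + 1) / 4 : ℝ) : ℂ))) =
      cexp (-z ^ 2 / (((w + 1) / w : ℝ) : ℂ)) := by
    rw [← Complex.exp_add]
    congr 1
    push_cast
    field_simp
    ring
  rw [e1, e2, e3, e4, e5, e6, ← e7]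
  have hy' : (y:ℂ) ≠ 0 := by exact_mod_cast hy.ne'
  push_cast
  field_simp
  rw [hs]
  ring
end

section
/- Let ν, μ ∈ ℂ with Re ν < 0 and Re μ < 1, and let z ∈ ℂ with Re z > |Im z|. Then (∫₀^∞ e^(−z·s − s²/2) s^(−ν−1) ds) · (∫₀^∞ e^(−z·t − t²/2) t^(−ν−μ) dt) = (2^(1−μ/2) · Γ(1−ν−μ)/Γ(1−μ)) · e^(z²/2) · ∫₀^∞ e^((2ν+μ)·t − (z²/2)·coth t) · (sinh 2t)^(−μ/2) · (∫₀^∞ e^(−z·√(coth t)·u − u²/2) u^(−μ) du) dt. (This is Corollary 1, eq. (43): D_ν(z)·D_(ν+μ−1)(z) = (2^(1−μ/2)/Γ(−ν)) ∫₀^∞ e^((2ν+μ)t − (z²/4)coth t) · D_(μ−1)(z√(coth t)) · (sinh 2t)^(−μ/2) dt, written with each parabolic cylinder function replaced by its Laplace-integral representation.) -/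
open MeasureTheory Complex Set

theorem gauss_cov {S : Set ℝ} (hS : MeasurableSet S) (hc : Convex ℝ S) {g g' : ℝ → ℝ}
    (hd : ∀ x ∈ S, HasDerivAt g (g' x) x) (hp' : ∀ x ∈ S, 0 ≤ g' x)
    (hs : ∀ ξ, ∃ x ∈ S, g x = ξ) :
    ∫⁻ x in S, ENNReal.ofReal (g' x * Real.exp (-(g x)^2)) = ENNReal.ofReal √Real.pi := by
  have hm : MonotoneOn g S := by
    apply monotoneOn_of_deriv_nonneg hc
    · intro x hx; exact (hd x hx).continuousAt.continuousWithinAt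
    · intro x hx; exact (hd x (interior_subset hx)).differentiableAt.differentiableWithinAt
    · intro x hx; rw [(hd x (interior_subset hx)).deriv]; exact hp' x (interior_subset hx)
  have h := lintegral_image_eq_lintegral_deriv_mul_of_monotoneOn hS
    (fun x hx => (hd x hx).hasDerivWithinAt) hm
    (fun x => ENNReal.ofReal (Real.exp (-x^2)))
  have himg : g '' S = univ := by
    ext ξ; simp only [mem_image, mem_univ, iff_true]; exact hs ξ
  rw [himg, Measure.restrict_univ] at h
  have h2 : ∫⁻ x : ℝ, ENNReal.ofReal (Real.exp (-x^2)) = ENNReal.ofReal √Real.pi := by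
    rw [← ofReal_integral_eq_lintegral_ofReal]
    · congr 1
      have := integral_gaussian 1
      simpa using this
    · have := integrable_exp_neg_mul_sq (b := 1) one_pos
      simpa using this
    · exact Filter.Eventually.of_forall fun x => (Real.exp_pos _).le
  rw [← h2, h]
  apply setLIntegral_congr_fun hS
  intro x hx
  simp only
  rw [ENNReal.ofReal_mul (hp' x hx)]

theorem levy {κ : ℝ} (hκ : 0 < κ) :
    ∫⁻ x in Ioi (0:ℝ), ENNReal.ofReal (κ / (2 * √Real.pi) / (x * √x) * Real.exp (-x - κ^2/(4*x)))
      = ENNReal.ofReal (Real.exp (-κ)) := by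
  have h1 := gauss_cov (S := Ioi (0:ℝ)) measurableSet_Ioi (convex_Ioi 0)
    (g := fun x => √x - κ / (2 * √x)) (g' := fun x => 1/(2*√x) + κ / (4 * (x * √x)))
    (by
      intro x hx
      have hx : 0 < x := hx
      have hs : 0 < √x := Real.sqrt_pos.2 hx
      have e1 : HasDerivAt (fun x => √x) (1/(2*√x)) x := Real.hasDerivAt_sqrt hx.ne'
      have e2 : HasDerivAt (fun x => κ / (2 * √x)) _ x := (hasDerivAt_const x κ).div (e1.const_mul 2) (by positivity)
      have e3 : HasDerivAt (fun x => √x - κ / (2 * √x)) _ x := e1.sub e2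
      have hxx : x = √x * √x := (Real.mul_self_sqrt hx.le).symm
      refine e3.congr_deriv ?_
      clear e3 e2 e1
      generalize √x = s at *
      subst hxx
      field_simp
      ring)
    (by
      intro x hx
      have hx : 0 < x := hx
      positivity)
    (by
      intro ξ
      have hq : 0 < ξ^2 + 2 * κ := by positivity
      set r := √(ξ^2+2*κ) with hr
      have hr2 : r^2 = ξ^2 + 2*κ := Real.sq_sqrt hq.le
      have hrp : 0 < r := Real.sqrt_pos.2 hq
      have hs : 0 < (ξ + r)/2 := by nlinarith
      refine ⟨((ξ + r)/2)^2, by simp only [mem_Ioi]; positivity, ?_⟩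
      rw [Real.sqrt_sq hs.le]
      have : ξ + r ≠ 0 := by linarith
      field_simp
      nlinarith)
  have hsq : ∀ x : ℝ, 0 < x → (√x - κ / (2 * √x))^2 = x - κ + κ^2/(4*x) := by
    intro x hx
    have hs : 0 < √x := Real.sqrt_pos.2 hx
    have hxx : x = √x * √x := (Real.mul_self_sqrt hx.le).symm
    generalize √x = s at *
    subst hxx
    field_simp
    ring
  set E := fun x : ℝ => Real.exp (-(√x - κ / (2 * √x))^2) with hE
  have hsplit : ∫⁻ x in Ioi (0:ℝ), ENNReal.ofReal ((1/(2*√x) + κ / (4 * (x * √x))) * E x)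
     = (∫⁻ x in Ioi (0:ℝ), ENNReal.ofReal (1/(2*√x) * E x)) +
       ∫⁻ x in Ioi (0:ℝ), ENNReal.ofReal (κ / (4 * (x * √x)) * E x) := by
    rw [← lintegral_add_left (by fun_prop)]
    apply setLIntegral_congr_fun measurableSet_Ioi
    intro x hx
    have hx : 0 < x := hx
    simp only
    rw [← ENNReal.ofReal_add (by positivity) (by positivity), add_mul]
  have hinv : (∫⁻ x in Ioi (0:ℝ), ENNReal.ofReal (1/(2*√x) * E x)) =
       ∫⁻ x in Ioi (0:ℝ), ENNReal.ofReal (κ / (4 * (x * √x)) * E x) := by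
    have hd : ∀ x ∈ Ioi (0:ℝ), HasDerivWithinAt (fun x => κ^2/4 * x⁻¹) (κ^2/4 * (-(x^2)⁻¹)) (Ioi 0) x := by
      intro x hx
      exact ((hasDerivAt_inv (ne_of_gt hx)).const_mul _).hasDerivWithinAt
    have hinj : InjOn (fun x => κ^2/4 * x⁻¹) (Ioi 0) := by
      intro x hx y hy h
      have : κ^2/4 ≠ 0 := by positivity
      simpa [this] using h
    have h := lintegral_image_eq_lintegral_abs_deriv_mul measurableSet_Ioi hd hinj
      (fun x => ENNReal.ofReal (1/(2*√x) * E x))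
    have himg : (fun x => κ^2/4 * x⁻¹) '' (Ioi 0) = Ioi 0 := by
      ext y
      constructor
      · rintro ⟨x, hx, rfl⟩
        have hx : 0 < x := hx
        simp only [mem_Ioi]; positivity
      · intro hy
        have hy : 0 < y := hy
        refine ⟨κ^2/4 * y⁻¹, by simp only [mem_Ioi]; positivity, ?_⟩
        simp only
        field_simp
    rw [himg] at h
    rw [h]
    apply setLIntegral_congr_fun measurableSet_Ioi
    intro x hx
    have hx : 0 < x := hx
    simp only
    rw [← ENNReal.ofReal_mul (abs_nonneg _)]
    congr 1
    have hE' : E (κ^2/4 * x⁻¹) = E x := by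
      simp only [hE]
      rw [hsq _ (by positivity), hsq _ hx]
      congr 1
      field_simp
      ring
    rw [hE']
    have hs : 0 < √x := Real.sqrt_pos.2 hx
    have hs2 : √(κ^2/4*x⁻¹) = κ / (2 * √x) := by
      rw [show κ^2/4*x⁻¹ = (κ / (2 * √x))^2 by rw [div_pow, mul_pow, Real.sq_sqrt hx.le]; field_simp; norm_num]
      exact Real.sqrt_sq (by positivity)
    rw [hs2, mul_neg, abs_neg, abs_of_pos (by positivity)]
    have hxx : x = √x * √x := (Real.mul_self_sqrt hx.le).symm
    generalize √x = s at *
    generalize E x = e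
    subst hxx
    field_simp
  rw [hsplit, hinv, ← two_mul] at h1
  have : ∀ x ∈ Ioi (0:ℝ), ENNReal.ofReal (κ / (2 * √Real.pi) / (x * √x) * Real.exp (-x - κ^2/(4*x)))
     = ENNReal.ofReal (Real.exp (-κ) / √Real.pi) * (2 * ENNReal.ofReal (κ / (4 * (x * √x)) * E x)) := by
    intro x hx
    have hx : 0 < x := hx
    rw [show (2:ENNReal) = ENNReal.ofReal 2 by simp, ← ENNReal.ofReal_mul (by norm_num), ← ENNReal.ofReal_mul (by positivity)]
    congr 1
    simp only [hE]
    rw [hsq x hx, show -x - κ^2/(4*x) = -κ + -(x - κ + κ^2/(4*x)) by ring, Real.exp_add]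
    have : 0 < √x := Real.sqrt_pos.2 hx
    have : 0 < √Real.pi := Real.sqrt_pos.2 Real.pi_pos
    field_simp
    ring
  rw [setLIntegral_congr_fun measurableSet_Ioi this, lintegral_const_mul' _ _ (by simp), lintegral_const_mul' _ _ (by simp), h1,
    ← ENNReal.ofReal_mul (by positivity)]
  congr 1
  have : 0 < √Real.pi := Real.sqrt_pos.2 Real.pi_pos
  field_simp


theorem inner_cov {p y z Q : ℝ} (hp : 0 < p) (hy : p < y) (hz : 0 < z) (hQ : 0 < Q) :
    ∫⁻ t in Ioo (√(y - √(y^2-p^2))) (√(y + √(y^2-p^2))),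
      ENNReal.ofReal ((Q/t+z*t)/(2*√Real.pi*t) /
        ((y - (p^2/t^2+t^2)/2) * √(y - (p^2/t^2+t^2)/2)) *
        Real.exp (-(Q/t+z*t)^2/(4*(y - (p^2/t^2+t^2)/2))))
    = ENNReal.ofReal (Real.exp (-(Q^2+2*z*Q*y+z^2*p^2)/(2*(y^2-p^2))) / √(y^2-p^2)) := by
  have hS0 : 0 < y^2 - p^2 := by nlinarith
  set S := √(y^2-p^2) with hS
  have hSp : 0 < S := Real.sqrt_pos.2 hS0
  have hS2 : S^2 = y^2-p^2 := Real.sq_sqrt hS0.le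
  have hSy : S < y := by nlinarith
  set t1 := √(y - S) with ht1
  set t2 := √(y + S) with ht2
  have h1p : 0 < t1 := Real.sqrt_pos.2 (by linarith)
  have h12 : t1 < t2 := Real.sqrt_lt_sqrt (by linarith) (by linarith)
  have h1s : t1^2 = y - S := Real.sq_sqrt (by linarith)
  have h2s : t2^2 = y + S := Real.sq_sqrt (by linarith)
  set W := fun t : ℝ => y - (p^2/t^2+t^2)/2 with hW
  have hWt : ∀ t, 0 < t → 2 * t^2 * W t = S^2 - (t^2-y)^2 := by
    intro t ht
    simp only [hW]
    rw [hS2]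
    field_simp
    ring
  have hWp : ∀ t ∈ Ioo t1 t2, 0 < W t := by
    intro t ht
    have ht0 : 0 < t := h1p.trans ht.1
    have a1 : y - S < t^2 := by rw [← h1s]; exact pow_lt_pow_left₀ ht.1 h1p.le (by norm_num)
    have a2 : t^2 < y + S := by rw [← h2s]; exact pow_lt_pow_left₀ ht.2 ht0.le (by norm_num)
    have := hWt t ht0
    have h3 : 0 < S^2 - (t^2-y)^2 := by nlinarith
    rw [← this] at h3
    exact pos_of_mul_pos_right h3 (by positivity)
  have hg := gauss_cov (S := Ioo t1 t2) measurableSet_Ioo (convex_Ioo _ _)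
    (g := fun t => (z*(t*y-p^2/t) + Q*(t - y/t)) / (2 * √(W t) * S))
    (g' := fun t => S * (Q/t+z*t) / (2 * t * (W t * √(W t))))
    (by
      intro t ht
      have ht0 : 0 < t := h1p.trans ht.1
      have hw := hWp t ht
      have hsw : 0 < √(W t) := Real.sqrt_pos.2 hw
      have d1 : HasDerivAt (fun t : ℝ => t⁻¹) (-(t^2)⁻¹) t := hasDerivAt_inv ht0.ne'
      have dN : HasDerivAt (fun t : ℝ => z*(t*y-p^2/t) + Q*(t - y/t)) (z*(y+p^2/t^2) + Q*(1+y/t^2)) t := by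
        have := ((((hasDerivAt_id t).mul_const y).sub (d1.const_mul (p^2))).const_mul z).add
          (((hasDerivAt_id t).sub (d1.const_mul y)).const_mul Q)
        refine this.congr_deriv ?_
        field_simp
        ring
      have dW : HasDerivAt W (p^2/t^3 - t) t := by
        have := ((((d1.pow 2).const_mul (p^2)).add ((hasDerivAt_id t).pow 2)).div_const 2).const_sub y
        have h2 : HasDerivAt W (-((p ^ 2 * ((2:ℕ) * t⁻¹ ^ (2 - 1) * -(t ^ 2)⁻¹) + (2:ℕ) * id t ^ (2 - 1) * 1) / 2)) t := by
          refine this.congr_of_eventuallyEq (Filter.Eventually.of_forall fun x => ?_)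
          simp only [hW]
          simp [div_eq_mul_inv]
        refine h2.congr_deriv ?_
        simp
        field_simp
        ring
      have dsW := dW.sqrt hw.ne'
      have dg := dN.div ((dsW.const_mul 2).mul_const S) (by positivity)
      refine dg.congr_deriv ?_
      have hwe : √(W t) * √(W t) = W t := Real.mul_self_sqrt hw.le
      have hWe : W t = y - (p^2/t^2+t^2)/2 := rfl
      have key : 2 * S^2 * (Q/t+z*t) = t*((z*(y+p^2/t^2) + Q*(1+y/t^2)) * (2 * W t) - (z*(t*y-p^2/t) + Q*(t - y/t)) * (p^2/t^3 - t)) := by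
        rw [hWe, hS2]
        field_simp
        ring
      generalize W t = w at *
      generalize √w = s at *
      generalize z*(y+p^2/t^2) + Q*(1+y/t^2) = X at *
      generalize z*(t*y-p^2/t) + Q*(t - y/t) = Y at *
      generalize p^2/t^3 - t = Z at *
      generalize Q/t+z*t = K at *
      clear dg dsW dW dN d1 hWe
      subst hwe
      field_simp
      linear_combination (-1) * key)
    (by
      intro t ht
      have ht0 : 0 < t := h1p.trans ht.1
      have hw := hWp t ht
      positivity)
    (by
      intro ξ
      have hcont : ContinuousOn (fun t => (z*(t*y-p^2/t) + Q*(t - y/t)) - ξ * (2 * √(W t) * S)) (Icc t1 t2) := by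
        have hne : ∀ t ∈ Icc t1 t2, t ≠ 0 := fun t ht => (h1p.trans_le ht.1).ne'
        have hne2 : ∀ t ∈ Icc t1 t2, t^2 ≠ 0 := fun t ht => pow_ne_zero 2 (hne t ht)
        simp only [hW]
        fun_prop (disch := assumption)
      have hW1 : W t1 = 0 := by
        have := hWt t1 h1p
        rw [h1s] at this
        have h3 : 2 * (y - S) * W t1 = 0 := by rw [this]; ring
        have : 2 * (y - S) ≠ 0 := by linarith
        simpa [this] using h3
      have hW2 : W t2 = 0 := by
        have := hWt t2 (h1p.trans h12)
        rw [h2s] at this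
        have h3 : 2 * (y + S) * W t2 = 0 := by rw [this]; ring
        have : 2 * (y + S) ≠ 0 := by linarith
        simpa [this] using h3
      have hN : ∀ t, 0 < t → (z*(t*y-p^2/t) + Q*(t - y/t)) = ((z*y+Q)*t^2 - z*p^2-Q*y)/t := by
        intro t ht
        field_simp
        ring
      have hpp : p^2 = y^2 - S^2 := by linarith
      have := intermediate_value_Ioo h12.le hcont
      have hm : (0:ℝ) ∈ Ioo ((z*(t1*y-p^2/t1) + Q*(t1 - y/t1)) - ξ * (2 * √(W t1) * S))
          ((z*(t2*y-p^2/t2) + Q*(t2 - y/t2)) - ξ * (2 * √(W t2) * S)) := by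
        rw [hW1, hW2, hN t1 h1p, hN t2 (h1p.trans h12), h1s, h2s, hpp]
        simp only [Real.sqrt_zero, mul_zero, zero_mul, sub_zero]
        constructor
        · apply div_neg_of_neg_of_pos _ h1p
          have : 0 < S * (z * (y - S) + Q) := by
            have : 0 < y - S := by linarith
            positivity
          nlinarith
        · apply div_pos _ (h1p.trans h12)
          have : 0 < S * (z * (y + S) + Q) := by
            have : 0 < y := by linarith
            positivity
          nlinarith
      obtain ⟨t, ht, hgt⟩ := this hm
      refine ⟨t, ht, ?_⟩
      have hw := hWp t ht
      have hsw : 0 < √(W t) := Real.sqrt_pos.2 hw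
      simp only at hgt ⊢
      rw [div_eq_iff (by positivity)]
      linarith)
  have : ∀ t ∈ Ioo t1 t2, ENNReal.ofReal ((Q/t+z*t)/(2*√Real.pi*t) /
        (W t * √(W t)) * Real.exp (-(Q/t+z*t)^2/(4*(W t)))) =
      ENNReal.ofReal (Real.exp (-(Q^2+2*z*Q*y+z^2*p^2)/(2*(y^2-p^2))) / S / √Real.pi) *
      ENNReal.ofReal (S * (Q/t+z*t) / (2 * t * (W t * √(W t))) *
        Real.exp (-((z*(t*y-p^2/t) + Q*(t - y/t)) / (2 * √(W t) * S))^2)) := by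
    intro t ht
    have ht0 : 0 < t := h1p.trans ht.1
    have hw := hWp t ht
    have hsw : 0 < √(W t) := Real.sqrt_pos.2 hw
    have hpi : 0 < √Real.pi := Real.sqrt_pos.2 Real.pi_pos
    rw [← ENNReal.ofReal_mul (by positivity)]
    congr 1
    have hexp : -(Q/t+z*t)^2/(4*(W t)) = -(Q^2+2*z*Q*y+z^2*p^2)/(2*(y^2-p^2)) +
       -((z*(t*y-p^2/t) + Q*(t - y/t)) / (2 * √(W t) * S))^2 := by
      rw [div_pow, mul_pow, mul_pow, Real.sq_sqrt hw.le, ← hS2]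
      have key : (Q/t+z*t)^2 * S^2 = 2 * W t * (Q^2+2*z*Q*y+z^2*p^2) + (z*(t*y-p^2/t) + Q*(t - y/t))^2 := by
        rw [hS2]
        simp only [hW]
        field_simp
        ring
      generalize W t = w at *
      generalize Q^2+2*z*Q*y+z^2*p^2 = X at *
      generalize z*(t*y-p^2/t) + Q*(t - y/t) = Y at *
      generalize Q/t+z*t = K at *
      field_simp
      linear_combination (-4) * key
    rw [hexp, Real.exp_add]
    generalize √(W t) = s at *
    generalize Real.exp _ = e1
    generalize Real.exp _ = e2
    generalize Q/t+z*t = K at *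
    field_simp
  rw [setLIntegral_congr_fun measurableSet_Ioo this, lintegral_const_mul' _ _ (by simp), hg,
    ← ENNReal.ofReal_mul (by positivity)]
  congr 1
  have hpi : 0 < √Real.pi := Real.sqrt_pos.2 Real.pi_pos
  field_simp

theorem LR_lint {p z Q : ℝ} (hp : 0 < p) (hz : 0 < z) (hQ : 0 < Q) :
    ∫⁻ t in Ioi (0:ℝ), ENNReal.ofReal (Real.exp (-(Q/t+z*t) - (p^2/t^2+t^2)/2) / t) =
    ∫⁻ y in Ioi p, ENNReal.ofReal
      (Real.exp (-y + -(Q^2+2*z*Q*y+z^2*p^2)/(2*(y^2-p^2))) / √(y^2-p^2)) := by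
  set V := fun t : ℝ => (p^2/t^2+t^2)/2 with hV
  set Φ : ℝ → ℝ → ENNReal := fun t y => if V t < y then ENNReal.ofReal (Real.exp (-y)) *
    ENNReal.ofReal ((Q/t+z*t)/(2*√Real.pi*t) / ((y - V t) * √(y - V t)) *
        Real.exp (-(Q/t+z*t)^2/(4*(y - V t)))) else 0 with hΦ
  have hmV : Measurable V := by fun_prop
  have hmΦ : Measurable (Function.uncurry Φ) := by
    simp only [hΦ, Function.uncurry_def]
    apply Measurable.ite
    · exact measurableSet_lt (by fun_prop) (by fun_prop)
    · fun_prop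
    · fun_prop
  have hL : ∀ t ∈ Ioi (0:ℝ), ENNReal.ofReal (Real.exp (-(Q/t+z*t) - V t) / t) = ∫⁻ y, Φ t y := by
    intro t ht
    have ht : 0 < t := ht
    have hκ : 0 < Q/t+z*t := by positivity
    have h := levy hκ
    rw [show Real.exp (-(Q/t+z*t) - V t) / t = Real.exp (-V t) / t * Real.exp (-(Q/t+z*t)) by
      rw [sub_eq_add_neg, Real.exp_add]; ring, ENNReal.ofReal_mul (by positivity), ← h,
      ← lintegral_indicator measurableSet_Ioi, ← lintegral_sub_right_eq_self _ (V t),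
      ← lintegral_const_mul' _ _ (by simp)]
    congr 1
    ext y
    simp only [hΦ, indicator, mem_Ioi, sub_pos]
    split_ifs with hy
    · have : 0 < y - V t := by linarith
      rw [← ENNReal.ofReal_mul (by positivity), ← ENNReal.ofReal_mul (by positivity)]
      congr 1
      rw [show -(y - V t) - (Q/t+z*t)^2/(4*(y-V t)) = V t + -y + -(Q/t+z*t)^2/(4*(y-V t)) by ring,
        Real.exp_add, Real.exp_add, Real.exp_neg (V t)]
      have : 0 < Real.exp (V t) := Real.exp_pos _
      have hpi : 0 < √Real.pi := Real.sqrt_pos.2 Real.pi_pos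
      field_simp
    · simp
  rw [setLIntegral_congr_fun measurableSet_Ioi hL, lintegral_lintegral_swap hmΦ.aemeasurable,
    ← lintegral_indicator measurableSet_Ioi]
  congr 1
  ext y
  by_cases hy : p < y
  · rw [indicator_of_mem (by exact hy), Real.exp_add, mul_div_assoc, ENNReal.ofReal_mul (by positivity),
      ← inner_cov hp hy hz hQ, ← lintegral_const_mul' _ _ (by simp),
      ← lintegral_indicator measurableSet_Ioi, ← lintegral_indicator measurableSet_Ioo]
    congr 1
    ext t
    have hS0 : 0 < y^2 - p^2 := by nlinarith
    have hSp : 0 < √(y^2-p^2) := Real.sqrt_pos.2 hS0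
    have hS2 : √(y^2-p^2)^2 = y^2-p^2 := Real.sq_sqrt hS0.le
    have hSy : √(y^2-p^2) < y := by nlinarith
    set S := √(y^2-p^2)
    have hiff : t ∈ Ioo (√(y-S)) (√(y+S)) ↔ t ∈ Ioi 0 ∧ V t < y := by
      by_cases ht : 0 < t
      · have e : V t < y ↔ (t^2-y)^2 < S^2 := by
          have : 2 * t^2 * (y - V t) = S^2 - (t^2-y)^2 := by
            rw [hS2]; simp only [hV]; field_simp; ring
          constructor
          · intro h
            have : 0 < 2 * t^2 * (y - V t) := mul_pos (by positivity) (by linarith)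
            linarith
          · intro h
            have : 0 < 2 * t^2 * (y - V t) := by linarith
            have := pos_of_mul_pos_right this (by positivity)
            linarith
        rw [e, mem_Ioo, Real.sqrt_lt' ht, Real.lt_sqrt ht.le, sq_lt_sq, abs_of_pos hSp, abs_lt, mem_Ioi]
        constructor
        · rintro ⟨a, b⟩; exact ⟨ht, by linarith, by linarith⟩
        · rintro ⟨_, a, b⟩; exact ⟨by linarith, by linarith⟩
      · constructor
        · intro h; exact absurd ((Real.sqrt_nonneg _).trans_lt h.1) ht
        · intro h; exact absurd h.1 ht
    by_cases h : t ∈ Ioo (√(y-S)) (√(y+S))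
    · rw [indicator_of_mem h, indicator_of_mem (hiff.1 h).1]
      simp only [hΦ]
      rw [if_pos (hiff.1 h).2]
    · rw [indicator_of_notMem h]
      by_cases h0 : t ∈ Ioi (0:ℝ)
      · rw [indicator_of_mem h0]
        simp only [hΦ]
        rw [if_neg (fun hh => h (hiff.2 ⟨h0, hh⟩))]
      · rw [indicator_of_notMem h0]
  · rw [indicator_of_notMem (by exact hy)]
    rw [setLIntegral_congr_fun (g := fun _ => 0) measurableSet_Ioi]
    · simp
    · intro t ht
      have ht : 0 < t := ht
      simp only [hΦ]
      rw [if_neg]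
      simp only [hV, not_lt] at hy ⊢
      have : 0 ≤ (p/t - t)^2 := sq_nonneg _
      have e : (p/t-t)^2 = p^2/t^2 + t^2 - 2*p := by field_simp; ring
      linarith


noncomputable def Kc (z : ℂ) (p q t : ℝ) : ℂ :=
  cexp (-z * ((p/t+t : ℝ):ℂ) - (((p^2/t^2+t^2)/2 + q/t : ℝ):ℂ)) / (t:ℂ)

noncomputable def Rc (z : ℂ) (p q y : ℝ) : ℂ :=
  cexp (-z^2 * ((p/(y-p) : ℝ):ℂ) - z * ((q/(y-p) : ℝ):ℂ) - ((y + q^2/(2*(y^2-p^2)) : ℝ):ℂ)) /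
    ((√(y^2-p^2) : ℝ):ℂ)

noncomputable def Kr (z : ℝ) (p q t : ℝ) : ℝ :=
  Real.exp (-z * (p/t+t) - ((p^2/t^2+t^2)/2 + q/t)) / t

noncomputable def Rr (z : ℝ) (p q y : ℝ) : ℝ :=
  Real.exp (-z^2 * (p/(y-p)) - z * (q/(y-p)) - (y + q^2/(2*(y^2-p^2)))) / √(y^2-p^2)

theorem Kc_ofReal (z p q t : ℝ) : Kc z p q t = (Kr z p q t : ℂ) := by
  simp only [Kc, Kr]; push_cast; rfl

theorem Rc_ofReal (z p q y : ℝ) : Rc z p q y = (Rr z p q y : ℂ) := by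
  simp only [Rc, Rr]; push_cast; rfl

theorem Kc_norm_eq {z : ℂ} {p q t : ℝ} (ht : 0 < t) : ‖Kc z p q t‖ = Kr z.re p q t := by
  simp only [Kc, Kr]
  rw [norm_div, Complex.norm_exp, Complex.norm_real, Real.norm_of_nonneg ht.le]
  congr 2
  rw [Complex.sub_re, Complex.re_mul_ofReal, Complex.ofReal_re, Complex.neg_re]

theorem Kr_mono {x x' p q t : ℝ} (h : x ≤ x') (hp : 0 < p) (ht : 0 < t) :
    Kr x' p q t ≤ Kr x p q t := by
  simp only [Kr]
  gcongr ?_ / _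
  apply Real.exp_le_exp.2
  have : 0 < p/t+t := by positivity
  nlinarith

theorem Kc_norm_le {z : ℂ} {x p q t : ℝ} (h : x ≤ z.re) (hp : 0 < p) (ht : 0 < t) :
    ‖Kc z p q t‖ ≤ Kr x p q t := by
  rw [Kc_norm_eq ht]; exact Kr_mono h hp ht

theorem Rc_norm_le {z : ℂ} {x p q y : ℝ} (h : x ≤ z.re) (h2 : x^2 ≤ (z^2).re) (hp : 0 < p) (hq : 0 < q)
    (hy : p < y) : ‖Rc z p q y‖ ≤ Rr x p q y := by
  simp only [Rc, Rr]
  rw [norm_div, Complex.norm_exp, Complex.norm_real, Real.norm_of_nonneg (Real.sqrt_nonneg _)]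
  gcongr ?_ / _
  apply Real.exp_le_exp.2
  rw [Complex.sub_re, Complex.sub_re, Complex.re_mul_ofReal, Complex.re_mul_ofReal, Complex.ofReal_re, Complex.neg_re]
  have hy' : 0 < y - p := by linarith
  have : 0 < p/(y-p) := by positivity
  have : 0 < q/(y-p) := by positivity
  nlinarith

theorem Kr_nonneg {x p q t : ℝ} (ht : 0 < t) : 0 ≤ Kr x p q t := by
  simp only [Kr]; positivity

theorem Rr_nonneg {x p q t : ℝ} : 0 ≤ Rr x p q t := by
  simp only [Rr]; positivity

theorem Kr_meas (x : ℝ) : Measurable (fun a : ℝ × ℝ × ℝ => Kr x a.2.1 a.2.2 a.1) := by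
  unfold Kr; fun_prop

theorem Rr_meas (x : ℝ) : Measurable (fun a : ℝ × ℝ × ℝ => Rr x a.2.1 a.2.2 a.1) := by
  unfold Rr; fun_prop

theorem Kc_meas (x : ℂ) : Measurable (fun a : ℝ × ℝ × ℝ => Kc x a.2.1 a.2.2 a.1) := by
  unfold Kc; fun_prop

theorem Rc_meas (x : ℂ) : Measurable (fun a : ℝ × ℝ × ℝ => Rc x a.2.1 a.2.2 a.1) := by
  unfold Rc; fun_prop

theorem LR_lint' {p z q : ℝ} (hp : 0 < p) (hz : 0 < z) (hq : 0 < q) :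
    ∫⁻ t in Ioi (0:ℝ), ENNReal.ofReal (Kr z p q t) =
    ∫⁻ y in Ioi p, ENNReal.ofReal (Rr z p q y) := by
  have h := LR_lint (p := p) (z := z) (Q := q + z * p) hp hz (by positivity)
  convert h using 1
  · apply setLIntegral_congr_fun measurableSet_Ioi
    intro t ht
    have ht : 0 < t := ht
    simp only [Kr]
    congr 3
    ring
  · apply setLIntegral_congr_fun measurableSet_Ioi
    intro y hy
    have hy : p < y := hy
    simp only [Rr]
    congr 3
    have h1 : y - p ≠ 0 := by linarith
    have h2 : y + p ≠ 0 := by linarith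
    rw [show y^2-p^2 = (y-p)*(y+p) by ring]
    field_simp
    ring

theorem Kr_int {p z q : ℝ} (hp : 0 < p) (hz : 0 < z) (hq : 0 < q) :
    IntegrableOn (fun t => Kr z p q t) (Ioi 0) := by
  have h1 : IntegrableOn (fun t : ℝ => q⁻¹ * Real.exp (-z * t)) (Ioi 0) :=
    (exp_neg_integrableOn_Ioi 0 hz).const_mul _
  refine Integrable.mono' h1 ?_ ?_
  · unfold Kr; exact Measurable.aestronglyMeasurable (by fun_prop)
  · rw [ae_restrict_iff' measurableSet_Ioi]
    refine Filter.Eventually.of_forall fun t ht => ?_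
    have ht : 0 < t := ht
    rw [Real.norm_of_nonneg (Kr_nonneg ht)]
    simp only [Kr]
    have h2 : Real.exp (-z * (p/t+t) - ((p^2/t^2+t^2)/2 + q/t)) ≤ Real.exp (-z*t) * Real.exp (-(q/t)) := by
      rw [← Real.exp_add]
      apply Real.exp_le_exp.2
      have : 0 < z * (p/t) := by positivity
      have : 0 < p^2/t^2+t^2 := by positivity
      nlinarith
    have h3 : Real.exp (-(q/t)) ≤ t / q := by
      rw [Real.exp_neg, inv_le_comm₀ (Real.exp_pos _) (by positivity), inv_div]
      linarith [Real.add_one_le_exp (q/t)]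
    rw [div_le_iff₀ ht]
    refine h2.trans ?_
    calc _ ≤ Real.exp (-z*t) * (t/q) := by gcongr
      _ = _ := by ring

theorem Rr_int {p z q : ℝ} (hp : 0 < p) (hz : 0 < z) (hq : 0 < q) :
    IntegrableOn (fun t => Rr z p q t) (Ioi p) := by
  have hm : Measurable (fun t => Rr z p q t) := by unfold Rr; fun_prop
  refine ⟨hm.aestronglyMeasurable, ?_⟩
  rw [hasFiniteIntegral_iff_ofReal (Filter.Eventually.of_forall fun t => Rr_nonneg), ← LR_lint' hp hz hq,
    ← hasFiniteIntegral_iff_ofReal]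
  · exact (Kr_int hp hz hq).2
  · rw [Filter.EventuallyLE, ae_restrict_iff' measurableSet_Ioi]
    exact Filter.Eventually.of_forall fun t ht => Kr_nonneg ht

theorem LR_real {p z q : ℝ} (hp : 0 < p) (hz : 0 < z) (hq : 0 < q) :
    ∫ t in Ioi (0:ℝ), Kr z p q t = ∫ y in Ioi p, Rr z p q y := by
  rw [integral_eq_lintegral_of_nonneg_ae _ (Kr_int hp hz hq).1,
    integral_eq_lintegral_of_nonneg_ae _ (Rr_int hp hz hq).1, LR_lint' hp hz hq]
  · exact Filter.Eventually.of_forall fun t => Rr_nonneg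
  · rw [Filter.EventuallyLE, ae_restrict_iff' measurableSet_Ioi]
    exact Filter.Eventually.of_forall fun t ht => Kr_nonneg ht

theorem diffOn_param {S : Set ℝ} (hS : MeasurableSet S) {F F' : ℂ → ℝ → ℂ} {U : Set ℂ}
    (hm : ∀ z, Measurable (F z)) (hm' : ∀ z, Measurable (F' z))
    (hd : ∀ z y, HasDerivAt (fun z => F z y) (F' z y) z)
    (hb : ∀ z ∈ U, ∃ V : Set ℂ, IsOpen V ∧ z ∈ V ∧ ∃ bound : ℝ → ℝ, IntegrableOn bound S ∧
      ∀ y ∈ S, ∀ w ∈ V, ‖F w y‖ ≤ bound y) :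
    DifferentiableOn ℂ (fun z => ∫ y in S, F z y) U := by
  intro z hz
  obtain ⟨V, hV, hzV, bound, hbi, hb⟩ := hb z hz
  obtain ⟨r, hr, hrV⟩ := Metric.isOpen_iff.1 hV z hzV
  have h := hasDerivAt_integral_of_dominated_loc_of_deriv_le (μ := volume.restrict S) (F := F) (F' := F') (x₀ := z)
    (s := Metric.ball z (r/2)) (bound := fun y => bound y / (r/3)) (Metric.ball_mem_nhds z (by positivity))
    (Filter.Eventually.of_forall fun w => (hm w).aestronglyMeasurable)
    (Integrable.mono' hbi (hm z).aestronglyMeasurable (by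
      rw [ae_restrict_iff' hS]
      exact Filter.Eventually.of_forall fun y hy => hb y hy z hzV))
    (hm' z).aestronglyMeasurable
    (by
      rw [ae_restrict_iff' hS]
      refine Filter.Eventually.of_forall fun y hy w hw => ?_
      rw [← (hd w y).deriv]
      apply Complex.norm_deriv_le_of_forall_mem_sphere_norm_le (by positivity)
      · apply Differentiable.diffContOnCl
        exact fun u => (hd u y).differentiableAt
      · intro u hu
        apply hb y hy
        apply hrV
        rw [Metric.mem_ball] at hw ⊢
        rw [mem_sphere_iff_norm, ← dist_eq_norm] at hu
        linarith [dist_triangle u w z])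
    (hbi.div_const _)
    (Filter.Eventually.of_forall fun y w hw => hd w y)
  exact h.2.differentiableAt.differentiableWithinAt

theorem sector_x {z : ℂ} (hz : |z.im| < z.re) : ∃ x : ℝ, 0 < x ∧ x < z.re ∧ x^2 < (z^2).re := by
  have hre : 0 < z.re := (abs_nonneg _).trans_lt hz
  have h2 : 0 < (z^2).re := by
    have : (z^2).re = z.re^2 - z.im^2 := by rw [sq, Complex.mul_re]; ring
    rw [this]
    have := sq_lt_sq' (by linarith [abs_nonneg z.im]) hz
    rw [sq_abs] at this
    linarith
  have h3 : (z^2).re ≤ z.re^2 := by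
    have : (z^2).re = z.re^2 - z.im^2 := by rw [sq, Complex.mul_re]; ring
    nlinarith
  have hs : √(z^2).re ^ 2 = (z^2).re := Real.sq_sqrt h2.le
  have hsp : 0 < √(z^2).re := Real.sqrt_pos.2 h2
  refine ⟨√(z^2).re / 2, by positivity, ?_, ?_⟩
  · nlinarith
  · nlinarith

theorem LR_complex {z : ℂ} {p q : ℝ} (hz : |z.im| < z.re) (hp : 0 < p) (hq : 0 < q) :
    ∫ t in Ioi (0:ℝ), Kc z p q t = ∫ y in Ioi p, Rc z p q y := by
  set U : Set ℂ := {z | |z.im| < z.re} with hU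
  have hUo : IsOpen U := isOpen_lt (by fun_prop) (by fun_prop)
  have hUc : Convex ℝ U := by
    intro u hu v hv a b ha hb hab
    simp only [hU, mem_ofPred_eq] at *
    rw [abs_lt] at *
    simp only [Complex.add_re, Complex.add_im, Complex.smul_re, Complex.smul_im, smul_eq_mul]
    rcases eq_or_lt_of_le ha with h | h
    · subst h
      have : b = 1 := by linarith
      subst this
      constructor <;> linarith
    · constructor <;> nlinarith
  have hnb : ∀ z ∈ U, ∃ x : ℝ, 0 < x ∧ z ∈ {w : ℂ | x < w.re ∧ x^2 < (w^2).re} ∧ IsOpen {w : ℂ | x < w.re ∧ x^2 < (w^2).re} := by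
    intro z hz
    obtain ⟨x, hx, h1, h2⟩ := sector_x hz
    refine ⟨x, hx, ⟨h1, h2⟩, ?_⟩
    have o1 : IsOpen {w : ℂ | x < w.re} := isOpen_lt (by fun_prop) (by fun_prop)
    have o2 : IsOpen {w : ℂ | x^2 < (w^2).re} := isOpen_lt (by fun_prop) (by fun_prop)
    exact o1.inter o2
  have hK : DifferentiableOn ℂ (fun z => ∫ t in Ioi (0:ℝ), Kc z p q t) U := by
    apply diffOn_param measurableSet_Ioi (F := fun z t => Kc z p q t)
      (F' := fun z t => cexp (-z * ((p/t+t : ℝ):ℂ) - (((p^2/t^2+t^2)/2 + q/t : ℝ):ℂ)) * (-((p/t+t : ℝ):ℂ)) / (t:ℂ))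
    · intro z; unfold Kc; fun_prop
    · intro z; fun_prop
    · intro z t
      unfold Kc
      have := ((((hasDerivAt_id z).neg.mul_const ((p/t+t : ℝ):ℂ)).sub_const (((p^2/t^2+t^2)/2 + q/t : ℝ):ℂ)).cexp).div_const (t:ℂ)
      refine this.congr_deriv ?_
      simp
    · intro z hz
      obtain ⟨x, hx, h1, h2⟩ := hnb z hz
      refine ⟨_, h2, h1, _, Kr_int hp hx hq, ?_⟩
      intro y hy w hw
      exact Kc_norm_le hw.1.le hp hy
  have hR : DifferentiableOn ℂ (fun z => ∫ t in Ioi p, Rc z p q t) U := by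
    apply diffOn_param measurableSet_Ioi (F := fun z t => Rc z p q t)
      (F' := fun z y => cexp (-z^2 * ((p/(y-p) : ℝ):ℂ) - z * ((q/(y-p) : ℝ):ℂ) - ((y + q^2/(2*(y^2-p^2)) : ℝ):ℂ)) *
        (-(2*z) * ((p/(y-p) : ℝ):ℂ) - ((q/(y-p) : ℝ):ℂ)) / ((√(y^2-p^2) : ℝ):ℂ))
    · intro z; unfold Rc; fun_prop
    · intro z; fun_prop
    · intro z y
      unfold Rc
      have := ((((((hasDerivAt_id z).pow 2).neg.mul_const ((p/(y-p) : ℝ):ℂ)).sub ((hasDerivAt_id z).mul_const ((q/(y-p) : ℝ):ℂ))).sub_const ((y + q^2/(2*(y^2-p^2)) : ℝ):ℂ)).cexp).div_const ((√(y^2-p^2) : ℝ):ℂ)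
      refine this.congr_deriv ?_
      simp
    · intro z hz
      obtain ⟨x, hx, h1, h2⟩ := hnb z hz
      refine ⟨_, h2, h1, _, Rr_int hp hx hq, ?_⟩
      intro y hy w hw
      exact Rc_norm_le hw.1.le hw.2.le hp hq hy
  have h1U : (1:ℂ) ∈ U := by simp [hU]
  refine (hK.analyticOnNhd hUo).eqOn_of_preconnected_of_frequently_eq (hR.analyticOnNhd hUo)
    hUc.isPreconnected h1U ?_ hz
  have ht : Filter.Tendsto (fun x : ℝ => (x:ℂ)) (nhdsWithin 1 {1}ᶜ) (nhdsWithin 1 {1}ᶜ) := by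
    apply tendsto_nhdsWithin_of_tendsto_nhds_of_eventually_within
    · have : Filter.Tendsto (fun x : ℝ => (x:ℂ)) (nhds 1) (nhds ((1:ℝ):ℂ)) := Complex.continuous_ofReal.tendsto 1
      simp only [Complex.ofReal_one] at this
      exact this.mono_left nhdsWithin_le_nhds
    · filter_upwards [self_mem_nhdsWithin] with x hx
      simpa using hx
  apply ht.frequently
  apply Filter.Eventually.frequently
  have : ∀ᶠ x : ℝ in nhds 1, 0 < x := lt_mem_nhds one_pos
  filter_upwards [nhdsWithin_le_nhds this] with x hx
  simp only [Kc_ofReal, Rc_ofReal]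
  rw [integral_complex_ofReal, integral_complex_ofReal, LR_real hp hx hq]


noncomputable abbrev MM : Measure ℝ := volume.restrict (Ioi (0:ℝ))

theorem ae_MM {P : ℝ → Prop} (h : ∀ t, 0 < t → P t) : ∀ᵐ t ∂MM, P t := by
  rw [ae_restrict_iff' measurableSet_Ioi]
  exact Filter.Eventually.of_forall h

theorem ae_MM2 {P : ℝ × ℝ → Prop} (h : ∀ p q, 0 < p → 0 < q → P (p, q)) :
    ∀ᵐ w ∂(MM.prod MM), P w := by
  rw [Measure.prod_restrict, ae_restrict_iff' (measurableSet_Ioi.prod measurableSet_Ioi)]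
  exact Filter.Eventually.of_forall fun w hw => h w.1 w.2 hw.1 hw.2

theorem ae_MM3 {P : ℝ × ℝ × ℝ → Prop} (h : ∀ t p q, 0 < t → 0 < p → 0 < q → P (t, p, q)) :
    ∀ᵐ w ∂(MM.prod (MM.prod MM)), P w := by
  rw [Measure.prod_restrict, Measure.prod_restrict,
    ae_restrict_iff' (measurableSet_Ioi.prod (measurableSet_Ioi.prod measurableSet_Ioi))]
  exact Filter.Eventually.of_forall fun w hw => h w.1 w.2.1 w.2.2 hw.1 hw.2.1 hw.2.2

theorem phi_int {z a : ℂ} (hz : 0 < z.re) (ha : 0 < a.re) :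
    Integrable (fun s : ℝ => cexp (-z * s - (s:ℂ)^2 / 2) * (s:ℂ) ^ (a - 1)) MM := by
  have h1 : IntegrableOn (fun x : ℝ => x ^ (a.re - 1) * Real.exp (-(1/2) * x ^ 2)) (Ioi 0) :=
    integrableOn_rpow_mul_exp_neg_mul_sq (by norm_num) (by linarith)
  refine Integrable.mono' h1 (Measurable.aestronglyMeasurable (by fun_prop)) (ae_MM fun s hs => ?_)
  rw [norm_mul, Complex.norm_cpow_eq_rpow_re_of_pos hs, Complex.norm_exp, mul_comm]
  gcongr ?_ * ?_
  · simp
  · apply Real.exp_le_exp.2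
    have : ((s:ℂ)^2/2) = ((s^2/2 : ℝ) : ℂ) := by push_cast; rfl
    rw [this, Complex.sub_re, Complex.re_mul_ofReal, Complex.ofReal_re, Complex.neg_re]
    nlinarith [mul_pos hz hs]

noncomputable def GG (z a c : ℂ) (w : ℝ × ℝ × ℝ) : ℂ :=
  (w.2.1:ℂ)^(a-1) * (w.2.2:ℂ)^(c-1) * Kc z w.2.1 w.2.2 w.1

theorem GG_meas (z a c : ℂ) : Measurable (GG z a c) := by
  have := Kc_meas z
  unfold GG; fun_prop

theorem GG_eq {z a c : ℂ} {t p q : ℝ} (ht : 0 < t) (hp : 0 < p) (hq : 0 < q) :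
    GG z a c (t, p, q) = (cexp (-z * t - (t:ℂ)^2 / 2) * (t:ℂ) ^ (a + c - 1)) *
      (((t:ℂ)⁻¹ * (cexp (-z * (t⁻¹ * p : ℝ) - ((t⁻¹ * p : ℝ):ℂ)^2 / 2) * ((t⁻¹ * p : ℝ):ℂ) ^ (a - 1))) *
      ((t:ℂ)⁻¹ * (((-(t⁻¹ * q)).exp : ℝ) * ((t⁻¹ * q : ℝ):ℂ) ^ (c - 1)))) := by
  have htc : (t:ℂ) ≠ 0 := by exact_mod_cast ht.ne'
  have e1 : (p:ℂ)^(a-1) = (t:ℂ)^(a-1) * ((t⁻¹ * p : ℝ):ℂ)^(a-1) := by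
    rw [← Complex.mul_cpow_ofReal_nonneg ht.le (by positivity)]
    congr 1
    push_cast; field_simp
  have e2 : (q:ℂ)^(c-1) = (t:ℂ)^(c-1) * ((t⁻¹ * q : ℝ):ℂ)^(c-1) := by
    rw [← Complex.mul_cpow_ofReal_nonneg ht.le (by positivity)]
    congr 1
    push_cast; field_simp
  have e3 : (t:ℂ)^(a+c-1) = (t:ℂ)^(a-1) * (t:ℂ)^(c-1) * t := by
    rw [show a+c-1 = (a-1)+(c-1)+1 by ring, Complex.cpow_add _ _ htc, Complex.cpow_add _ _ htc, Complex.cpow_one]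
  simp only [GG, Kc]
  rw [e1, e2, e3]
  have e4 : cexp (-z * ((p/t+t : ℝ):ℂ) - (((p^2/t^2+t^2)/2 + q/t : ℝ):ℂ)) =
     cexp (-z * t - (t:ℂ)^2 / 2) * cexp (-z * (t⁻¹ * p : ℝ) - ((t⁻¹ * p : ℝ):ℂ)^2 / 2) * ((-(t⁻¹ * q)).exp : ℝ) := by
    rw [Complex.ofReal_exp, ← Complex.exp_add, ← Complex.exp_add]
    congr 1
    push_cast
    field_simp
    ring
  rw [e4]
  field_simp

theorem scale_int {f : ℝ → ℂ} (hf : Integrable f MM) {t : ℝ} (ht : 0 < t) :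
    Integrable (fun p => (t:ℂ)⁻¹ * f (t⁻¹ * p)) MM := by
  apply Integrable.const_mul
  have := (integrableOn_Ioi_comp_mul_left_iff f 0 (inv_pos.2 ht)).2
  rw [mul_zero] at this
  exact this hf

theorem scale_val (f : ℝ → ℂ) {t : ℝ} (ht : 0 < t) :
    ∫ p, (t:ℂ)⁻¹ * f (t⁻¹ * p) ∂MM = ∫ p, f p ∂MM := by
  rw [integral_const_mul, integral_comp_mul_left_Ioi f 0 (inv_pos.2 ht), mul_zero, inv_inv, Complex.real_smul,
    inv_mul_cancel_left₀ (by exact_mod_cast ht.ne')]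

theorem scale_norm (f : ℝ → ℂ) {t : ℝ} (ht : 0 < t) :
    ∫ p, ‖(t:ℂ)⁻¹ * f (t⁻¹ * p)‖ ∂MM = ∫ p, ‖f p‖ ∂MM := by
  simp only [norm_mul, norm_inv, Complex.norm_real, Real.norm_of_nonneg ht.le]
  rw [integral_const_mul, integral_comp_mul_left_Ioi (fun p => ‖f p‖) 0 (inv_pos.2 ht), mul_zero, inv_inv, smul_eq_mul,
    inv_mul_cancel_left₀ ht.ne']

theorem GG_int {z a c : ℂ} (hz : 0 < z.re) (ha : 0 < a.re) (hc : 0 < c.re) :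
    Integrable (GG z a c) (MM.prod (MM.prod MM)) := by
  have hφ := phi_int hz ha
  have hψ : Integrable (fun x : ℝ => ((-x).exp : ℝ) * (x:ℂ) ^ (c - 1)) MM := GammaIntegral_convergent hc
  rw [integrable_prod_iff (GG_meas z a c).aestronglyMeasurable]
  constructor
  · refine ae_MM fun t ht => ?_
    refine Integrable.congr (((scale_int hφ ht).mul_prod (scale_int hψ ht)).const_mul
      (cexp (-z * t - (t:ℂ)^2 / 2) * (t:ℂ) ^ (a + c - 1))) (ae_MM2 fun p q hp hq => ?_)
    simp only
    rw [GG_eq ht hp hq]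
  · have hχ := (phi_int hz (a := a + c) (by rw [Complex.add_re]; positivity)).norm
    refine Integrable.congr (hχ.mul_const ((∫ p : ℝ, ‖cexp (-z * p - (p:ℂ)^2 / 2) * (p:ℂ) ^ (a - 1)‖ ∂MM) *
      ∫ x : ℝ, ‖((-x).exp : ℝ) * (x:ℂ) ^ (c - 1)‖ ∂MM)) (ae_MM fun t ht => ?_)
    simp only
    rw [← scale_norm (fun p : ℝ => cexp (-z * p - (p:ℂ)^2 / 2) * (p:ℂ) ^ (a - 1)) ht,
      ← scale_norm (fun x : ℝ => ((-x).exp : ℝ) * (x:ℂ) ^ (c - 1)) ht, ← integral_prod_mul, ← integral_const_mul]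
    apply integral_congr_ae
    refine ae_MM2 fun p q hp hq => ?_
    simp only
    rw [GG_eq ht hp hq, ← norm_mul, ← norm_mul]

theorem GG_val {z a c : ℂ} (hz : 0 < z.re) (ha : 0 < a.re) (hc : 0 < c.re) :
    ∫ w, GG z a c w ∂(MM.prod (MM.prod MM)) =
     (∫ t : ℝ, cexp (-z * t - (t:ℂ)^2 / 2) * (t:ℂ) ^ (a + c - 1) ∂MM) *
     ((∫ p : ℝ, cexp (-z * p - (p:ℂ)^2 / 2) * (p:ℂ) ^ (a - 1) ∂MM) * Complex.Gamma c) := by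
  rw [integral_prod _ (GG_int hz ha hc), ← integral_mul_const]
  apply integral_congr_ae
  refine ae_MM fun t ht => ?_
  simp only
  rw [Complex.Gamma_eq_integral hc, Complex.GammaIntegral,
    ← scale_val (fun p : ℝ => cexp (-z * p - (p:ℂ)^2 / 2) * (p:ℂ) ^ (a - 1)) ht,
    ← scale_val (fun x : ℝ => ((-x).exp : ℝ) * (x:ℂ) ^ (c - 1)) ht, ← integral_prod_mul, ← integral_const_mul]
  apply integral_congr_ae
  refine ae_MM2 fun p q hp hq => ?_
  simp only
  rw [GG_eq ht hp hq]

noncomputable def HH (z a c : ℂ) (w : ℝ × ℝ × ℝ) : ℂ :=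
  (w.2.1:ℂ)^(a-1) * (w.2.2:ℂ)^(c-1) * (if w.2.1 < w.1 then Rc z w.2.1 w.2.2 w.1 else 0)

theorem HH_meas (z a c : ℂ) : Measurable (HH z a c) := by
  unfold HH
  have : Measurable (fun w : ℝ × ℝ × ℝ => if w.2.1 < w.1 then Rc z w.2.1 w.2.2 w.1 else 0) :=
    Measurable.ite (measurableSet_lt (by fun_prop) (by fun_prop)) (Rc_meas z) measurable_const
  fun_prop

theorem cut_int {E : Type*} [NormedAddCommGroup E] [NormedSpace ℝ E] {p : ℝ} (hp : 0 < p) (f : ℝ → E) :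
    ∫ y, (if p < y then f y else 0) ∂MM = ∫ y in Ioi p, f y := by
  have : (fun y => if p < y then f y else 0) = (Ioi p).indicator f := by
    ext y; simp [indicator]
  rw [this, setIntegral_indicator measurableSet_Ioi, inter_eq_self_of_subset_right (Ioi_subset_Ioi hp.le)]

theorem HH_int {z a c : ℂ} (hz : |z.im| < z.re) (ha : 0 < a.re) (hc : 0 < c.re) :
    Integrable (HH z a c) (MM.prod (MM.prod MM)) := by
  obtain ⟨x, hx, hx1, hx2⟩ := sector_x hz
  set Hr : ℝ × ℝ × ℝ → ℝ := fun w => ‖(w.2.1:ℂ)^(a-1)‖ * ‖(w.2.2:ℂ)^(c-1)‖ * (if w.2.1 < w.1 then Rr x w.2.1 w.2.2 w.1 else 0) with hHr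
  have hm : Measurable Hr := by
    have : Measurable (fun w : ℝ × ℝ × ℝ => if w.2.1 < w.1 then Rr x w.2.1 w.2.2 w.1 else 0) :=
      Measurable.ite (measurableSet_lt (by fun_prop) (by fun_prop)) (Rr_meas x) measurable_const
    fun_prop
  have hpos : ∀ w, 0 ≤ Hr w := by
    intro w
    simp only [hHr]
    have : 0 ≤ (if w.2.1 < w.1 then Rr x w.2.1 w.2.2 w.1 else 0) := by
      split_ifs
      · exact Rr_nonneg
      · exact le_rfl
    positivity
  have hHri : Integrable Hr (MM.prod (MM.prod MM)) := by
    rw [integrable_prod_iff' hm.aestronglyMeasurable]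
    constructor
    · refine ae_MM2 fun p q hp hq => ?_
      simp only [hHr]
      apply Integrable.const_mul
      have : (fun y => if p < y then Rr x p q y else 0) = (Ioi p).indicator (Rr x p q) := by
        ext y; simp [indicator]
      rw [this, integrable_indicator_iff measurableSet_Ioi]
      exact (Rr_int hp hx hq).mono_measure Measure.restrict_le_self
    · have h := (GG_int (z := x) (a := a) (c := c) (by simpa using hx) ha hc).integral_norm_prod_right
      refine Integrable.congr h (ae_MM2 fun p q hp hq => ?_)
      simp only [Real.norm_of_nonneg (hpos _)]
      simp only [hHr]
      rw [integral_const_mul, cut_int hp, ← LR_real hp hx hq, ← integral_const_mul]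
      apply integral_congr_ae
      refine ae_MM fun t ht => ?_
      simp only [GG, norm_mul]
      rw [Kc_norm_eq ht, Complex.ofReal_re]
  refine Integrable.mono' hHri (HH_meas z a c).aestronglyMeasurable (ae_MM3 fun t p q ht hp hq => ?_)
  simp only [HH, hHr, norm_mul]
  gcongr
  split_ifs with h
  · exact Rc_norm_le hx1.le hx2.le hp hq h
  · simp

theorem GG_HH {z a c : ℂ} (hz : |z.im| < z.re) (ha : 0 < a.re) (hc : 0 < c.re) :
    ∫ w, GG z a c w ∂(MM.prod (MM.prod MM)) = ∫ w, HH z a c w ∂(MM.prod (MM.prod MM)) := by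
  have hre : 0 < z.re := (abs_nonneg _).trans_lt hz
  rw [integral_prod_symm _ (GG_int hre ha hc), integral_prod_symm _ (HH_int hz ha hc)]
  apply integral_congr_ae
  refine ae_MM2 fun p q hp hq => ?_
  simp only [GG, HH]
  rw [integral_const_mul, integral_const_mul, cut_int hp, LR_complex hz hp hq]

noncomputable def JJ (z a c : ℂ) (r v : ℝ) : ℂ :=
  (r:ℂ)^(a-1) * (v:ℂ)^(c-1) * (if r < 1 then
    cexp (-z^2 * ((r/(1-r) : ℝ):ℂ) - z * ((v/(1-r) : ℝ):ℂ) - ((v^2/(2*(1-r^2)) : ℝ):ℂ)) / ((√(1-r^2) : ℝ):ℂ) else 0)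

theorem HH_eq {z a c : ℂ} {y r v : ℝ} (hy : 0 < y) (hr : 0 < r) (hv : 0 < v) :
    (y:ℂ) * ((y:ℂ) * HH z a c (y, y * r, y * v)) = ((-y).exp : ℝ) * (y:ℂ)^(a+c-1) * JJ z a c r v := by
  have hyc : (y:ℂ) ≠ 0 := by exact_mod_cast hy.ne'
  have e3 : (y:ℂ)^(a+c-1) = (y:ℂ)^(a-1) * (y:ℂ)^(c-1) * y := by
    rw [show a+c-1 = (a-1)+(c-1)+1 by ring, Complex.cpow_add _ _ hyc, Complex.cpow_add _ _ hyc, Complex.cpow_one]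
  simp only [HH, JJ]
  rw [Complex.ofReal_mul, Complex.ofReal_mul, Complex.mul_cpow_ofReal_nonneg hy.le hr.le, Complex.mul_cpow_ofReal_nonneg hy.le hv.le, e3]
  have hiff : y * r < y ↔ r < 1 := by
    constructor
    · intro h; by_contra h'; nlinarith
    · intro h; nlinarith
  by_cases h : r < 1
  · rw [if_pos h, if_pos (hiff.2 h)]
    simp only [Rc]
    have h1r : 0 < 1 - r := by linarith
    have hrr : 0 < 1 - r^2 := by nlinarith
    have es : √(y^2 - (y*r)^2) = y * √(1-r^2) := by
      rw [show y^2 - (y*r)^2 = y^2 * (1-r^2) by ring, Real.sqrt_mul (by positivity), Real.sqrt_sq hy.le]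
    have hsp : ((√(1-r^2) : ℝ):ℂ) ≠ 0 := by exact_mod_cast (Real.sqrt_pos.2 hrr).ne'
    have f1 : y * r / (y - y * r) = r / (1-r) := by
      rw [show y - y * r = y * (1-r) by ring]; field_simp
    have f2 : y * v / (y - y * r) = v / (1-r) := by
      rw [show y - y * r = y * (1-r) by ring]; field_simp
    have f3 : (y*v)^2 / (2 * (y^2 - (y * r)^2)) = v^2 / (2*(1-r^2)) := by
      rw [show y^2 - (y * r)^2 = y^2 * (1-r^2) by ring]; field_simp
    rw [es, f1, f2, f3, Complex.ofReal_exp]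
    have e4 : cexp (-z^2 * ((r/(1-r) : ℝ):ℂ) - z * ((v/(1-r) : ℝ):ℂ) - ((y + v^2/(2*(1-r^2)) : ℝ):ℂ)) =
      cexp ((-y : ℝ):ℂ) * cexp (-z^2 * ((r/(1-r) : ℝ):ℂ) - z * ((v/(1-r) : ℝ):ℂ) - ((v^2/(2*(1-r^2)) : ℝ):ℂ)) := by
      rw [← Complex.exp_add]; congr 1; push_cast; ring
    rw [e4, Complex.ofReal_mul]
    generalize cexp _ = A1
    generalize cexp _ = A2
    field_simp
  · rw [if_neg h, if_neg (fun hh => h (hiff.1 hh))]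
    simp

theorem scale_val' (f : ℝ → ℂ) {y : ℝ} (hy : 0 < y) :
    ∫ p, f p ∂MM = (y:ℂ) * ∫ p, f (y * p) ∂MM := by
  rw [integral_comp_mul_left_Ioi f 0 hy, mul_zero, Complex.real_smul, Complex.ofReal_inv,
    mul_inv_cancel_left₀ (by exact_mod_cast hy.ne')]

theorem HH_val {z a c : ℂ} (hz : |z.im| < z.re) (ha : 0 < a.re) (hc : 0 < c.re) :
    ∫ w, HH z a c w ∂(MM.prod (MM.prod MM)) =
      Complex.Gamma (a + c) * ∫ r, ∫ v, JJ z a c r v ∂MM ∂MM := by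
  rw [integral_prod _ (HH_int hz ha hc), Complex.Gamma_eq_integral (by rw [Complex.add_re]; positivity),
    Complex.GammaIntegral, ← integral_mul_const]
  apply integral_congr_ae
  filter_upwards [(HH_int hz ha hc).prod_right_ae, ae_MM (P := fun t => 0 < t) fun t ht => ht] with y hi hy
  rw [integral_prod _ hi, scale_val' _ hy, ← integral_const_mul, ← integral_const_mul]
  apply integral_congr_ae
  refine ae_MM fun r hr => ?_
  simp only
  rw [scale_val' _ hy, ← integral_const_mul, ← integral_const_mul, ← integral_const_mul]
  apply integral_congr_ae
  refine ae_MM fun v hv => ?_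
  simp only
  rw [HH_eq hy hr hv]

lemma exp_lt_one_of_neg_aux {x : ℝ} (h : x < 0) : Real.exp x < 1 := by
  rw [← Real.exp_zero]; exact Real.exp_lt_exp.2 h


lemma pw_exp (x : ℝ) (w : ℂ) : ((Real.exp x : ℝ) : ℂ) ^ w = cexp (x * w) := by
  rw [cpow_def_of_ne_zero (by exact_mod_cast (Real.exp_pos x).ne'), ← Complex.ofReal_log (Real.exp_pos x).le, Real.log_exp]

lemma J_subst (z a c : ℂ) :
    ∫ r, ∫ v, JJ z a c r v ∂MM ∂MM =
      ∫ t in Ioi (0:ℝ), ((2 * Real.exp (-2*t) : ℝ) : ℂ) * ∫ v, JJ z a c (Real.exp (-2*t)) v ∂MM := by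
  have h1 : ∫ r, ∫ v, JJ z a c r v ∂MM ∂MM = ∫ r in Ioo (0:ℝ) 1, ∫ v, JJ z a c r v ∂MM := by
    refine setIntegral_eq_of_subset_of_forall_sdiff_eq_zero measurableSet_Ioi (fun x hx => hx.1) ?_
    intro x hx
    have : ¬ x < 1 := fun h => hx.2 ⟨hx.1, h⟩
    simp [JJ, this]
  have him : (fun t : ℝ => Real.exp (-2*t)) '' Ioi 0 = Ioo 0 1 := by
    ext x
    constructor
    · rintro ⟨t, ht, rfl⟩
      exact ⟨Real.exp_pos _, exp_lt_one_of_neg_aux (by linarith [mem_Ioi.1 ht])⟩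
    · rintro ⟨h0, h1⟩
      refine ⟨-Real.log x / 2, ?_, ?_⟩
      · have := Real.log_neg h0 h1
        show 0 < -Real.log x / 2
        linarith
      · show Real.exp (-2 * (-Real.log x / 2)) = x
        rw [show -2 * (-Real.log x / 2) = Real.log x by ring, Real.exp_log h0]
  rw [h1, ← him, integral_image_eq_integral_abs_deriv_smul (f' := fun t => Real.exp (-2*t) * (-2))
    measurableSet_Ioi]
  · refine integral_congr_ae (Filter.Eventually.of_forall fun t => ?_)
    have : |Real.exp (-2*t) * (-2)| = 2 * Real.exp (-2*t) := by
      rw [abs_mul, abs_of_pos (Real.exp_pos _)]; norm_num; ring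
    simp only [this, Complex.real_smul]
  · intro t _
    have h : HasDerivAt (fun t : ℝ => -2*t) (-2) t := by
      simpa using (hasDerivAt_id t).const_mul (-2:ℝ)
    exact h.exp.hasDerivWithinAt
  · intro x _ y _ h
    have := Real.exp_injective h
    linarith

lemma J_inner (z ν μ : ℂ) {t : ℝ} (ht : 0 < t) :
    ((2 * Real.exp (-2*t) : ℝ) : ℂ) * ∫ v, JJ z (-ν) (1-μ) (Real.exp (-2*t)) v ∂MM =
    ((2:ℂ) ^ (1 - μ/2) * cexp (z^2 / 2)) *
        (Complex.exp ((2 * ν + μ) * t - z^2 / 2 * (Real.cosh t / Real.sinh t : ℝ)) *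
          ((Real.sinh (2 * t) : ℝ) : ℂ) ^ (-μ/2) *
          (∫ u in Ioi (0:ℝ),
            Complex.exp (-z * (Real.sqrt (Real.cosh t / Real.sinh t) : ℝ) * u -
              (u:ℂ)^2 / 2) * (u:ℂ) ^ (-μ))) := by
  set r := Real.exp (-2*t) with hr
  have hr0 : 0 < r := Real.exp_pos _
  have hr1 : r < 1 := exp_lt_one_of_neg_aux (by linarith)
  have hd : 0 < 1 - r := by linarith
  have h1 : 0 < 1 - r^2 := by nlinarith
  set S := √(1-r^2) with hS
  have hS0 : 0 < S := Real.sqrt_pos.2 h1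
  have hS2 : S^2 = 1 - r^2 := Real.sq_sqrt h1.le
  set L := Real.log (1-r^2) with hL
  have hSe : S = Real.exp (L/2) := by
    rw [hS, Real.sqrt_eq_rpow, Real.rpow_def_of_pos h1]; congr 1; ring
  have hsh0 : 0 < Real.sinh t := Real.sinh_pos_iff.2 ht
  have he : Real.exp t * Real.exp t * r = 1 := by
    rw [hr, ← Real.exp_add, ← Real.exp_add]; simp; ring
  have hen : Real.exp (-t) = Real.exp t * r := by
    rw [hr, ← Real.exp_add]; congr 1; ring
  have hcoth : Real.cosh t / Real.sinh t = (1+r)/(1-r) := by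
    rw [div_eq_div_iff hsh0.ne' hd.ne', Real.cosh_eq, Real.sinh_eq, hen]; ring
  have hsq : √(Real.cosh t / Real.sinh t) = S/(1-r) := by
    rw [hcoth, Real.sqrt_eq_iff_mul_self_eq (by positivity) (by positivity)]
    field_simp; rw [hS2]; ring
  have hs2 : Real.sinh (2*t) = Real.exp (L + 2*t - Real.log 2) := by
    rw [Real.exp_sub, Real.exp_add, Real.exp_log h1, Real.exp_log (by norm_num), Real.sinh_eq]
    have : Real.exp (-(2*t)) = r := by rw [hr]; congr 1; ring
    have h3 : Real.exp (2*t) * r = 1 := by rw [← this, ← Real.exp_add]; simp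
    rw [this]; linear_combination (r/2) * h3
  have h2 : (2:ℂ)^(1-μ/2) = cexp (Real.log 2 * (1-μ/2)) := by
    rw [← pw_exp, Real.exp_log (by norm_num)]; norm_num
  have h2' : (2:ℂ) = cexp (Real.log 2) := by
    rw [← Complex.ofReal_exp, Real.exp_log (by norm_num)]; norm_num
  rw [scale_val' (JJ z (-ν) (1-μ) r) hS0, hsq, hs2, pw_exp, h2, hcoth]
  simp only [← integral_const_mul]
  refine setIntegral_congr_fun measurableSet_Ioi ?_
  intro u hu
  have hu0 : 0 < u := hu
  have e1 : (r:ℂ)^(-ν-1) = cexp (((-2*t:ℝ):ℂ) * (-ν-1)) := by rw [hr, pw_exp]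
  have e2 : ((S*u:ℝ):ℂ)^(1-μ-1) = cexp (((L/2:ℝ):ℂ) * (-μ)) * (u:ℂ)^(-μ) := by
    rw [Complex.ofReal_mul, mul_cpow_ofReal_nonneg hS0.le hu0.le, show 1-μ-1 = -μ by ring]
    congr 1
    rw [hSe, pw_exp]
  have e3 : (S*u)^2/(2*(1-r^2)) = u^2/2 := by
    rw [← hS2]; field_simp
  have e4 : r/(1-r) = ((1+r)/(1-r) - 1)/2 := by field_simp; ring
  have e5 : S*u/(1-r) = S/(1-r)*u := by ring
  have e6 : (2 * r : ℝ) = Real.exp (Real.log 2 + -2*t) := by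
    rw [Real.exp_add, Real.exp_log (by norm_num)]
  have hSc : (S:ℂ) ≠ 0 := by exact_mod_cast hS0.ne'
  simp only [JJ, if_pos hr1, e1, e2, e3, e4, e5, ← hS]
  rw [e6]
  generalize (1+r)/(1-r) = A
  generalize S/(1-r) = B
  have key2 : ∀ E1 E2 E3 E4 F1 F2 F3 F4 F5 U : ℂ, E1+E2+E3+E4 = F1+F2+F3+F4+F5 → 
     cexp E1 * ((S:ℂ) * (cexp E2 * (cexp E3 * U) * (cexp E4/(S:ℂ)))) = 
     cexp F1 * cexp (F2) * (cexp F3 * cexp F4 * (cexp F5 * U)) := by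
    intro E1 E2 E3 E4 F1 F2 F3 F4 F5 U h
    have : cexp E1 * cexp E2 * cexp E3 * cexp E4 = cexp F1 * cexp F2 * cexp F3 * cexp F4 * cexp F5 := by
      simp only [← Complex.exp_add, h]
    field_simp
    linear_combination U * this
  rw [Complex.ofReal_exp]
  apply key2
  push_cast
  ring

/-- Corollary 1, eq. (43): `D_ν(z) D_(ν+μ-1)(z) = (2^(1-μ/2)/Γ(-ν)) ∫₀^∞
e^((2ν+μ)t - (z²/4) coth t) D_(μ-1)(z √(coth t)) (sinh 2t)^(-μ/2) dt`, written with each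
parabolic cylinder function replaced by its Laplace-integral representation. -/
theorem nicholson_type_integral_same_argument
    (ν μ z : ℂ) (hν : ν.re < 0) (hμ : μ.re < 1) (hz : |z.im| < z.re) :
    (∫ s in Ioi (0:ℝ), Complex.exp (-z * s - (s:ℂ)^2 / 2) * (s:ℂ) ^ (-ν - 1)) *
      (∫ t in Ioi (0:ℝ), Complex.exp (-z * t - (t:ℂ)^2 / 2) * (t:ℂ) ^ (-ν - μ)) =
    ((2:ℂ) ^ (1 - μ/2) * Complex.Gamma (1 - ν - μ) / Complex.Gamma (1 - μ)) *
      Complex.exp (z^2 / 2) *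
      ∫ t in Ioi (0:ℝ),
        Complex.exp ((2 * ν + μ) * t - z^2 / 2 * (Real.cosh t / Real.sinh t : ℝ)) *
          ((Real.sinh (2 * t) : ℝ) : ℂ) ^ (-μ/2) *
          (∫ u in Ioi (0:ℝ),
            Complex.exp (-z * (Real.sqrt (Real.cosh t / Real.sinh t) : ℝ) * u -
              (u:ℂ)^2 / 2) * (u:ℂ) ^ (-μ)) := by
  have ha : 0 < (-ν).re := by simpa using hν
  have hc : 0 < (1-μ).re := by simpa using hμ
  have hz0 : 0 < z.re := lt_of_le_of_lt (abs_nonneg _) hz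
  have hG : Complex.Gamma (1-μ) ≠ 0 := Complex.Gamma_ne_zero_of_re_pos hc
  have h1 := GG_val hz0 ha hc
  rw [GG_HH hz ha hc, HH_val hz ha hc, J_subst,
    setIntegral_congr_fun measurableSet_Ioi (fun t ht => J_inner z ν μ ht),
    integral_const_mul, show -ν + (1-μ) = 1 - ν - μ by ring,
    show 1 - ν - μ - 1 = -ν - μ by ring] at h1
  rw [div_mul_eq_mul_div, div_mul_eq_mul_div, eq_div_iff hG]
  linear_combination -h1
end
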